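/- arXiv:2206.10008 — 6 statements merged into one kernel-verified Lean document; each statement's English description precedes it below -/
import Mathlib

section
/- Let W : y² + a₁xy + a₃y = x³ + a₂x² + a₄x + a₆ be a Weierstrass curve with integer coefficients whose discriminant Δ(W) is odd. If the group of rational points of W contains a point of order 2, then the standard Weierstrass invariants c₄(W) and c₆(W) are both odd; equivalently, the 2-adic signature (ν₂(c₄), ν₂(c₆), ν₂(Δ)) of W equals (0, 0, 0). -/
/-- The `x`-coordinate of a nonzero point killed by `2` is a root of the `2`-division
polynomial. -/
theorem exists_twoTorsion_root {F : Type*} [Field F] [DecidableEq F] (W : WeierstrassCurve F)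
    {P : W.toAffine.Point} (hP : P ≠ 0) (h2 : 2 • P = 0) :
    ∃ x : F, 4 * x ^ 3 + W.b₂ * x ^ 2 + 2 * W.b₄ * x + W.b₆ = 0 := by
  cases P with
  | zero => exact absurd rfl hP
  | some x y h =>
    have hneg : y = W.toAffine.negY x y := by
      by_contra hy
      rw [two_nsmul, WeierstrassCurve.Affine.Point.add_self_of_Y_ne hy] at h2
      exact WeierstrassCurve.Affine.Point.some_ne_zero _ h2
    have heq := (WeierstrassCurve.Affine.equation_iff _ _).1 h.1
    rw [WeierstrassCurve.Affine.negY] at hneg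
    refine ⟨x, ?_⟩
    simp only [WeierstrassCurve.b₂, WeierstrassCurve.b₄, WeierstrassCurve.b₆]
    linear_combination (2 * y + W.a₁ * x + W.a₃) * hneg - 4 * heq

/-- A rational root of a monic integral cubic is an integer. -/
theorem exists_int_eq_of_monic_cubic {r : ℚ} {a b c : ℤ}
    (hr : r ^ 3 + a * r ^ 2 + b * r + c = 0) : ∃ n : ℤ, (n : ℚ) = r := by
  have hint : IsIntegral ℤ r := by
    refine ⟨.X ^ 3 + .C a * .X ^ 2 + .C b * .X + .C c, by monicity!, ?_⟩
    simpa [-eq_intCast] using hr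
  simpa using IsIntegrallyClosed.isIntegral_iff.1 hint

/-- If `a₁` is even and `b₆` is odd, the `2`-division polynomial has no rational root. -/
theorem twoTorsion_polynomial_ne_zero (W : WeierstrassCurve ℤ) (h₁ : Even W.a₁) (h₆ : Odd W.b₆)
    (x : ℚ) : 4 * x ^ 3 + W.b₂ * x ^ 2 + 2 * W.b₄ * x + W.b₆ ≠ 0 := by
  intro hx
  obtain ⟨n, hn⟩ := exists_int_eq_of_monic_cubic (r := 4 * x) (a := W.b₂) (b := 8 * W.b₄)
    (c := 16 * W.b₆) (by push_cast; linear_combination 16 * hx)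
  have hroot : n ^ 3 + W.b₂ * n ^ 2 + 8 * W.b₄ * n + 16 * W.b₆ = 0 := by
    have : (n : ℚ) ^ 3 + W.b₂ * n ^ 2 + 8 * W.b₄ * n + 16 * W.b₆ = 0 := by
      rw [hn]; linear_combination 16 * hx
    exact_mod_cast this
  obtain ⟨k, hk⟩ := h₁
  have hb₂ : W.b₂ = 4 * (k ^ 2 + W.a₂) := by rw [WeierstrassCurve.b₂, hk]; ring
  have hb₄ : W.b₄ = 2 * (k * W.a₃ + W.a₄) := by rw [WeierstrassCurve.b₄, hk]; ring
  rw [hb₂, hb₄] at hroot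
  have hn₂ : (2 : ℤ) ∣ n := Int.prime_two.dvd_of_dvd_pow (n := 3)
    ⟨-(2 * (k ^ 2 + W.a₂) * n ^ 2 + 8 * (k * W.a₃ + W.a₄) * n + 8 * W.b₆), by
      linear_combination hroot⟩
  obtain ⟨m, rfl⟩ := hn₂
  have hm₂ : (2 : ℤ) ∣ m := Int.prime_two.dvd_of_dvd_pow (n := 3)
    ⟨-((k ^ 2 + W.a₂) * m ^ 2 + 2 * (k * W.a₃ + W.a₄) * m + W.b₆), by
      linarith⟩
  obtain ⟨t, rfl⟩ := hm₂
  rw [← Int.not_even_iff_odd, even_iff_two_dvd] at h₆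
  exact h₆ ⟨-(2 * (t ^ 3 + (k ^ 2 + W.a₂) * t ^ 2 + (k * W.a₃ + W.a₄) * t)), by linarith⟩

/-- If `Δ` is odd and `a₁` is even, then `b₆` is odd. -/
theorem odd_b₆_of_odd_discriminant (W : WeierstrassCurve ℤ) (hΔ : Odd W.Δ) (h₁ : Even W.a₁) :
    Odd W.b₆ := by
  have hb₂ : Even W.b₂ := by
    simp [WeierstrassCurve.b₂, h₁, parity_simps, show Even (4 : ℤ) by decide]
  rw [← Int.not_even_iff_odd] at hΔ ⊢
  intro hb₆
  exact hΔ (by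
    simp [WeierstrassCurve.Δ, hb₂, hb₆, parity_simps, show Even (8 : ℤ) by decide])

/-- If a Weierstrass curve with integer coefficients has odd `a₁`, then `c₄` and `c₆` are odd. -/
theorem odd_c₄_and_odd_c₆_of_odd_a₁ (W : WeierstrassCurve ℤ) (h₁ : Odd W.a₁) :
    Odd W.c₄ ∧ Odd W.c₆ := by
  have hb₂ : Odd W.b₂ := h₁.pow.add_even ((show Even (4 : ℤ) by decide).mul_right _)
  constructor
  · exact hb₂.pow.sub_even ((show Even (24 : ℤ) by decide).mul_right _)
  · exact (hb₂.pow.neg.add_even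
      (((show Even (36 : ℤ) by decide).mul_right _).mul_right _)).sub_even
      ((show Even (216 : ℤ) by decide).mul_right _)

/-- If a Weierstrass curve with integer coefficients has odd discriminant and its group of
rational points contains a point of order `2`, then its invariants `c₄` and `c₆` are both odd;
equivalently, its `2`-adic signature `(ν₂ c₄, ν₂ c₆, ν₂ Δ)` is `(0, 0, 0)`. -/
theorem odd_c4_c6_of_odd_discriminant_of_two_torsion (W : WeierstrassCurve ℤ)
    (hΔ : Odd W.Δ)
    (hP : ∃ P : (W.baseChange ℚ).toAffine.Point, P ≠ 0 ∧ 2 • P = 0) :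
    Odd W.c₄ ∧ Odd W.c₆ := by
  obtain ⟨P, hP, h2⟩ := hP
  obtain ⟨x, hx⟩ := exists_twoTorsion_root _ hP h2
  refine odd_c₄_and_odd_c₆_of_odd_a₁ W (Int.not_even_iff_odd.1 fun h₁ ↦ ?_)
  refine twoTorsion_polynomial_ne_zero W h₁ (odd_b₆_of_odd_discriminant W hΔ h₁) x ?_
  simpa [WeierstrassCurve.baseChange, WeierstrassCurve.map_b₂, WeierstrassCurve.map_b₄,
    WeierstrassCurve.map_b₆] using hx
end

section
/- Let W : y² + a₁xy + a₃y = x³ + a₂x² + a₄x + a₆ be a Weierstrass curve with integer coefficients whose discriminant Δ(W) is odd. If the group of rational points of W contains a point of order 2, then the coefficient a₁ is odd, and consequently b₂ = a₁² + 4a₂ is odd. -/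
/-- The `x`-coordinate of a nonzero point killed by `2` is a root of the two-torsion polynomial. -/
lemma WeierstrassCurve.Affine.Point.exists_two_torsion_root {F : Type*} [Field F] [DecidableEq F]
    {W : WeierstrassCurve.Affine F} {P : W.Point} (hP : P ≠ 0) (h2 : 2 • P = 0) :
    ∃ x : F, 4 * x ^ 3 + W.b₂ * x ^ 2 + 2 * W.b₄ * x + W.b₆ = 0 := by
  rcases P with _ | ⟨x, y, h⟩
  · exact absurd rfl hP
  · have hneg := eq_neg_of_add_eq_zero_left ((two_nsmul _).symm.trans h2)
    rw [WeierstrassCurve.Affine.Point.neg_some, WeierstrassCurve.Affine.Point.some.injEq] at hneg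
    have hy := hneg.2
    have heq := (WeierstrassCurve.Affine.equation_iff ..).mp h.1
    rw [WeierstrassCurve.Affine.negY] at hy
    refine ⟨x, ?_⟩
    rw [WeierstrassCurve.b₂, WeierstrassCurve.b₄, WeierstrassCurve.b₆]
    linear_combination (2 * y + W.a₁ * x + W.a₃) * hy - 4 * heq

/-- The cubic `4x³ + 4cx² + 4dx + b` with `b` odd has no rational root. -/
lemma four_mul_cubic_ne_zero_of_odd (c d b : ℤ) (hb : Odd b) (x : ℚ) :
    4 * x ^ 3 + 4 * c * x ^ 2 + 4 * d * x + b ≠ 0 := by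
  intro hx
  have hxq : x * x.den = x.num := Rat.mul_den_eq_num x
  have key : 4 * x.num ^ 3 + 4 * c * x.num ^ 2 * x.den + 4 * d * x.num * (x.den : ℤ) ^ 2
      + b * (x.den : ℤ) ^ 3 = 0 := by
    have : (4 * x.num ^ 3 + 4 * c * x.num ^ 2 * x.den + 4 * d * x.num * (x.den : ℚ) ^ 2
      + b * (x.den : ℚ) ^ 3) = 0 := by
      rw [← hxq]
      linear_combination (x.den : ℚ) ^ 3 * hx
    exact_mod_cast this
  have hcop : IsCoprime x.num x.den := Rat.isCoprime_num_den x
  generalize x.num = p at *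
  generalize (x.den : ℤ) = q at *
  have hqe : Even q := by
    have : Even (b * q ^ 3) :=
      ⟨-2 * (p ^ 3 + c * p ^ 2 * q + d * p * q ^ 2), by linear_combination key⟩
    simpa [Int.even_mul, Int.even_pow, Int.not_even_iff_odd.mpr hb] using this
  obtain ⟨r, rfl⟩ := hqe
  have hpe : Even p := by
    have : Even (p ^ 3) :=
      ⟨-(c * p ^ 2 * r + 2 * d * p * r ^ 2 + b * r ^ 3), by linarith⟩
    exact (Int.even_pow.mp this).1
  obtain ⟨s, rfl⟩ := hpe
  obtain ⟨u, v, huv⟩ := hcop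
  have : 2 * (u * s + v * r) = 1 := by linear_combination huv
  omega

/-- If a Weierstrass curve with integer coefficients has odd discriminant and its group of
rational points contains a point of order `2`, then the coefficient `a₁` is odd, and
consequently `b₂ = a₁² + 4·a₂` is odd. -/
theorem odd_a1_b2_of_odd_discriminant_of_two_torsion (W : WeierstrassCurve ℤ)
    (hΔ : Odd W.Δ)
    (hP : ∃ P : (W.baseChange ℚ).toAffine.Point, P ≠ 0 ∧ 2 • P = 0) :
    Odd W.a₁ ∧ Odd W.b₂ := by
  have ha : Odd W.a₁ := by
    by_contra ha
    obtain ⟨k, hk⟩ := Int.not_odd_iff_even.mp ha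
    obtain ⟨P, hP, h2⟩ := hP
    obtain ⟨x, hx⟩ := WeierstrassCurve.Affine.Point.exists_two_torsion_root hP h2
    have hb₂ : W.b₂ = 4 * (k ^ 2 + W.a₂) := by rw [WeierstrassCurve.b₂, hk]; ring
    have hb₄ : W.b₄ = 2 * (k * W.a₃ + W.a₄) := by rw [WeierstrassCurve.b₄, hk]; ring
    have hb₆ : Odd W.b₆ := by
      by_contra hb
      obtain ⟨m, hm⟩ := Int.not_odd_iff_even.mp hb
      refine Int.not_odd_iff_even.mpr ?_ hΔ
      rw [WeierstrassCurve.Δ, hb₂, hm]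
      simp [parity_simps, show Even (4 : ℤ) by decide, show Even (8 : ℤ) by decide]
    refine four_mul_cubic_ne_zero_of_odd (k ^ 2 + W.a₂) (k * W.a₃ + W.a₄) W.b₆ hb₆ x ?_
    rw [WeierstrassCurve.baseChange, WeierstrassCurve.map_b₂, WeierstrassCurve.map_b₄,
      WeierstrassCurve.map_b₆, hb₂, hb₄] at hx
    simp only [eq_intCast] at hx
    push_cast at hx ⊢
    linear_combination hx
  refine ⟨ha, ?_⟩
  rw [WeierstrassCurve.b₂]
  exact ha.pow.add_even ⟨2 * W.a₂, by ring⟩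
end

section
/- Let D be a nonzero squarefree integer and let E be the elliptic curve y² = x³ − D²x over ℚ. Then the rank of the abelian group E(ℚ) of rational points is at most 2ω(D) − ν₂(D). -/
/-- Multiplication by two on `ℤⁿ` has image of index `2 ^ n`. -/
lemma index_range_two_nsmul_pi_int (n : ℕ) :
    (nsmulAddMonoidHom 2 : (Fin n → ℤ) →+ (Fin n → ℤ)).range.index = 2 ^ n := by
  have h : (nsmulAddMonoidHom 2 : (Fin n → ℤ) →+ (Fin n → ℤ)).range =
      AddSubgroup.pi Set.univ fun _ ↦ AddSubgroup.zmultiples (2 : ℤ) := by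
    ext v
    simp only [AddMonoidHom.mem_range, nsmulAddMonoidHom_apply, AddSubgroup.mem_pi, Set.mem_univ,
      true_imp_iff, Int.mem_zmultiples_iff]
    constructor
    · rintro ⟨w, rfl⟩ i
      exact ⟨w i, by simp⟩
    · intro hv
      choose w hw using hv
      exact ⟨w, by ext i; simp [hw i]⟩
  rw [h, AddSubgroup.index_pi]
  simp

lemma index_range_two_nsmul_prod (A B : Type*) [AddCommGroup A] [AddCommGroup B] :
    (nsmulAddMonoidHom 2 : A × B →+ A × B).range.index =
      (nsmulAddMonoidHom 2 : A →+ A).range.index * (nsmulAddMonoidHom 2 : B →+ B).range.index := by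
  rw [← AddSubgroup.index_prod]
  congr 1
  ext ⟨a, b⟩
  simp only [AddMonoidHom.mem_range, nsmulAddMonoidHom_apply, AddSubgroup.mem_prod, Prod.exists,
    Prod.smul_mk, Prod.mk.injEq]
  exact ⟨fun ⟨x, y, hx, hy⟩ ↦ ⟨⟨x, hx⟩, ⟨y, hy⟩⟩, fun ⟨⟨x, hx⟩, ⟨y, hy⟩⟩ ↦ ⟨x, y, hx, hy⟩⟩

lemma AddEquiv.map_range_two_nsmul {G H : Type*} [AddCommGroup G] [AddCommGroup H] (e : G ≃+ H) :
    (nsmulAddMonoidHom 2 : G →+ G).range.map (e : G →+ H) =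
      (nsmulAddMonoidHom 2 : H →+ H).range := by
  ext h
  simp only [AddSubgroup.mem_map, AddMonoidHom.mem_range, nsmulAddMonoidHom_apply]
  constructor
  · rintro ⟨_, ⟨g, rfl⟩, rfl⟩
    exact ⟨e g, by simp⟩
  · rintro ⟨k, rfl⟩
    exact ⟨_, ⟨e.symm k, rfl⟩, by simp⟩

/-- For a finitely generated abelian group `G` of rank `r` one has
`[G : 2 • G] = 2 ^ r * (number of two-torsion points)`. -/
lemma AddCommGroup.exists_rank_le_index_range_two_nsmul (G : Type*) [AddCommGroup G]
    [AddGroup.FG G] :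
    ∃ r : ℕ, Module.rank ℤ G ≤ r ∧ (nsmulAddMonoidHom 2 : G →+ G).range.index =
      2 ^ r * Nat.card (nsmulAddMonoidHom 2 : G →+ G).ker := by
  obtain ⟨n, ι, _, p, hp, k, ⟨e₀⟩⟩ := AddCommGroup.equiv_free_prod_directSum_zmod G
  classical
  have (i : ι) : NeZero (p i ^ k i) := ⟨pow_ne_zero _ (hp i).ne_zero⟩
  let T := ∀ i, ZMod (p i ^ k i)
  have : Finite T := inferInstance
  let e : G ≃+ (Fin n → ℤ) × T := e₀.trans <| AddEquiv.prodCongr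
    (Finsupp.linearEquivFunOnFinite ℤ ℤ (Fin n)).toAddEquiv (DirectSum.addEquivProd _)
  refine ⟨n, ?_, ?_⟩
  · let f : G →ₗ[ℤ] (Fin n → ℤ) :=
      ((AddMonoidHom.fst _ _).comp (e : G →+ (Fin n → ℤ) × T)).toIntLinearMap
    have hf : LinearMap.ker f ≤ Submodule.torsion ℤ G := by
      intro g hg
      have hg : (e g).1 = 0 := hg
      rw [Submodule.mem_torsion_iff]
      refine ⟨⟨Nat.card T, mem_nonZeroDivisors_of_ne_zero (by simp)⟩, ?_⟩
      apply e.injective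
      change e ((Nat.card T : ℤ) • g) = e 0
      rw [map_zsmul, map_zero, natCast_zsmul]
      ext1
      · simp [hg]
      · exact card_nsmul_eq_zero'
    rw [← rank_quotient_eq_of_le_torsion hf]
    have := LinearMap.lift_rank_le_of_injective _ (LinearMap.ker_eq_bot.mp
      (Submodule.ker_liftQ_eq_bot' _ f rfl))
    simpa using this
  · have h := index_range_two_nsmul_prod (Fin n → ℤ) T
    have : (nsmulAddMonoidHom 2 : T →+ T).ker.FiniteIndex := inferInstance
    rw [index_range_two_nsmul_pi_int, AddSubgroup.index_range (f := nsmulAddMonoidHom (α := T) 2),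
      ← e.map_range_two_nsmul] at h
    have h₁ := AddSubgroup.index_map_equiv (nsmulAddMonoidHom 2 : G →+ G).range e
    rw [← h₁]
    refine h.trans ?_
    congr 1
    refine Nat.card_congr ⟨fun t ↦ ⟨e.symm (0, t), ?_⟩, fun g ↦ ⟨(e g).2, ?_⟩, ?_, ?_⟩
    · have ht : (2 : ℕ) • (t : T) = 0 := t.2
      change (2 : ℕ) • e.symm _ = 0
      rw [← map_nsmul]
      simp [ht]
    · have hg : (2 : ℕ) • (g : G) = 0 := g.2
      change (2 : ℕ) • (e g).2 = 0
      rw [← Prod.smul_snd, ← map_nsmul, hg]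
      simp
    · intro t; simp
    · intro g
      have hg : (2 : ℕ) • (g : G) = 0 := g.2
      have h₁ : (2 : ℕ) • (e g).1 = 0 := by
        rw [← Prod.smul_fst, ← map_nsmul, hg]
        simp
      have h₂ : (e g).1 = 0 := smul_eq_zero_iff_right two_ne_zero |>.mp h₁
      ext
      simp [← h₂]

lemma AddCommGroup.rank_add_two_le_of_card_le {G V : Type*} [AddCommGroup G] [AddGroup.FG G]
    [AddCommGroup V] [Finite V] (f : G →+ V) {n : ℕ} (hV : Nat.card V ≤ 2 ^ n)
    (hf : f.ker ≤ (nsmulAddMonoidHom 2 : G →+ G).range)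
    {t : Fin 4 → G} (ht : Function.Injective t) (ht₂ : ∀ i, 2 • t i = 0) :
    Module.rank ℤ G ≤ (n - 2 : ℕ) := by
  obtain ⟨r, hr, h⟩ := AddCommGroup.exists_rank_le_index_range_two_nsmul G
  refine hr.trans (Nat.cast_le.mpr ?_)
  have h₁ : f.ker.index ≤ 2 ^ n := by
    rw [AddSubgroup.index_ker]
    exact (Nat.card_le_card_of_injective _ Subtype.val_injective).trans hV
  have h₀ : f.ker.index ≠ 0 := by
    rw [AddSubgroup.index_ker]
    exact Nat.card_pos.ne'
  have h₂ := AddSubgroup.index_dvd_of_le hf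
  have : Finite (nsmulAddMonoidHom 2 : G →+ G).ker := by
    refine Nat.finite_of_card_ne_zero fun h₃ ↦ ?_
    rw [h₃, mul_zero] at h
    rw [h, zero_dvd_iff] at h₂
    exact h₀ h₂
  have h₄ := Nat.le_of_dvd h₀.bot_lt h₂
  have hG : 4 ≤ Nat.card (nsmulAddMonoidHom 2 : G →+ G).ker := by
    have := Nat.card_le_card_of_injective
      (fun i ↦ (⟨t i, ht₂ i⟩ : (nsmulAddMonoidHom 2 : G →+ G).ker))
      fun i j hij ↦ ht (congrArg Subtype.val hij)
    simpa using this
  have h₃ : 2 ^ (r + 2) ≤ 2 ^ n := by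
    rw [pow_add]
    nlinarith [Nat.mul_le_mul_left (2 ^ r) hG]
  have := (Nat.pow_le_pow_iff_right (by norm_num)).mp h₃
  omega

open WeierstrassCurve Height

/-- The congruent number curve `y² = x³ - d²x`. -/
abbrev congruentCurve (d : ℚ) : WeierstrassCurve ℚ :=
  { a₁ := 0, a₂ := 0, a₃ := 0, a₄ := -d ^ 2, a₆ := 0 }

namespace congruentCurve

variable {d : ℚ}

lemma isElliptic (hd : d ≠ 0) : (congruentCurve d).IsElliptic := by
  rw [isElliptic_iff, isUnit_iff_ne_zero]
  have : (congruentCurve d).Δ = 64 * d ^ 6 := by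
    simp only [Δ, b₂, b₄, b₆, b₈]
    ring
  rw [this]
  positivity

lemma equation_iff {x y : ℚ} :
    (congruentCurve d).toAffine.Equation x y ↔ y ^ 2 = x ^ 3 - d ^ 2 * x := by
  rw [Affine.equation_iff]
  constructor <;> intro h <;> linear_combination h

lemma nonsingular_iff (hd : d ≠ 0) {x y : ℚ} :
    (congruentCurve d).toAffine.Nonsingular x y ↔ y ^ 2 = x ^ 3 - d ^ 2 * x := by
  have := isElliptic hd
  rw [← Affine.equation_iff_nonsingular, equation_iff]

lemma negY_eq (x y : ℚ) : (congruentCurve d).toAffine.negY x y = -y := by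
  simp [Affine.negY]

lemma exists_add_some_of_X_ne {x₁ y₁ x₂ y₂ : ℚ} (hx : x₁ ≠ x₂)
    (h₁ : (congruentCurve d).toAffine.Nonsingular x₁ y₁)
    (h₂ : (congruentCurve d).toAffine.Nonsingular x₂ y₂) :
    ∃ h, Affine.Point.some x₁ y₁ h₁ + Affine.Point.some x₂ y₂ h₂ =
      Affine.Point.some (((y₁ - y₂) / (x₁ - x₂)) ^ 2 - x₁ - x₂)
        (-((y₁ - y₂) / (x₁ - x₂) * (((y₁ - y₂) / (x₁ - x₂)) ^ 2 - x₁ - x₂ - x₁) + y₁)) h := by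
  have key := Affine.Point.add_of_X_ne (h₁ := h₁) (h₂ := h₂) hx
  have hX : (congruentCurve d).toAffine.addX x₁ x₂
      ((congruentCurve d).toAffine.slope x₁ x₂ y₁ y₂) =
      ((y₁ - y₂) / (x₁ - x₂)) ^ 2 - x₁ - x₂ := by
    simp [Affine.slope_of_X_ne hx, Affine.addX]
  have hY : (congruentCurve d).toAffine.addY x₁ x₂ y₁
      ((congruentCurve d).toAffine.slope x₁ x₂ y₁ y₂) =
      -((y₁ - y₂) / (x₁ - x₂) * (((y₁ - y₂) / (x₁ - x₂)) ^ 2 - x₁ - x₂ - x₁) + y₁) := by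
    simp [Affine.slope_of_X_ne hx, Affine.addX, Affine.addY, Affine.negAddY, Affine.negY]
  simp only [hX, hY] at key
  exact ⟨_, key⟩

lemma exists_add_self_some {x y : ℚ} (hy : y ≠ 0)
    (h : (congruentCurve d).toAffine.Nonsingular x y) :
    ∃ h', Affine.Point.some x y h + Affine.Point.some x y h =
      Affine.Point.some (((3 * x ^ 2 - d ^ 2) / (2 * y)) ^ 2 - x - x)
        (-((3 * x ^ 2 - d ^ 2) / (2 * y) *
          (((3 * x ^ 2 - d ^ 2) / (2 * y)) ^ 2 - x - x - x) + y)) h' := by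
  have hne : y ≠ (congruentCurve d).toAffine.negY x y := by
    rw [negY_eq]
    exact fun h ↦ hy (by linarith)
  have key := Affine.Point.add_self_of_Y_ne (h₁ := h) hne
  have hs : (congruentCurve d).toAffine.slope x x y y = (3 * x ^ 2 - d ^ 2) / (2 * y) := by
    rw [Affine.slope_of_Y_ne rfl hne, negY_eq]
    simp only [mul_zero, zero_mul, add_zero, sub_zero]
    congr 1 <;> ring
  have hX : (congruentCurve d).toAffine.addX x x
      ((congruentCurve d).toAffine.slope x x y y) =
      ((3 * x ^ 2 - d ^ 2) / (2 * y)) ^ 2 - x - x := by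
    rw [hs]
    simp [Affine.addX]
  have hY : (congruentCurve d).toAffine.addY x x y
      ((congruentCurve d).toAffine.slope x x y y) =
      -((3 * x ^ 2 - d ^ 2) / (2 * y) *
        (((3 * x ^ 2 - d ^ 2) / (2 * y)) ^ 2 - x - x - x) + y) := by
    rw [hs]
    simp [Affine.addX, Affine.addY, Affine.negAddY, Affine.negY]
  simp only [hX, hY] at key
  exact ⟨_, key⟩

lemma addSubMap_eval (v : Fin 3 → ℚ) : (fun i ↦ (addSubMap (congruentCurve d) i).eval v) =
    ![v 0 ^ 2 + 2 * d ^ 2 * v 0 * v 2 + d ^ 4 * v 2 ^ 2,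
      2 * v 1 * v 0 - 2 * d ^ 2 * v 1 * v 2, v 1 ^ 2 - 4 * v 0 * v 2] := by
  ext i
  fin_cases i
  · simp [addSubMap, b₂, b₄, b₆, b₈]
    exact Or.inl (by ring)
  · simp [addSubMap, b₂, b₄, b₆, b₈]
    ring
  · simp [addSubMap, b₂, b₄, b₆, b₈]

lemma exists_smul_sym2x_eq_self (hd : d ≠ 0) (P : (congruentCurve d).toAffine.Point) :
    ∃ c : ℚ, c ≠ 0 ∧ c • (P + P).sym2x 0 =
      fun i ↦ (addSubMap (congruentCurve d) i).eval (P.sym2x P) := by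
  rw [addSubMap_eval]
  rcases P with _ | ⟨x, y, h⟩
  · exact ⟨1, one_ne_zero, by ext i; fin_cases i <;> simp [← Affine.Point.zero_def]⟩
  · have he := (nonsingular_iff hd).mp h
    by_cases hy : y = 0
    · rw [Affine.Point.add_self_of_Y_eq (by rw [negY_eq, hy, neg_zero])]
      refine ⟨x ^ 4 + 2 * d ^ 2 * x ^ 2 + d ^ 4, by positivity, ?_⟩
      ext i
      fin_cases i <;> simp
      · ring
      · linear_combination 4 * he - 4 * y * hy
      · ring
    · obtain ⟨h', key⟩ := exists_add_self_some hy h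
      rw [key]
      refine ⟨4 * y ^ 2, by positivity, ?_⟩
      ext i
      fin_cases i <;> simp
      · field_simp
        linear_combination (-32 * x) * he
      · linear_combination 4 * he
      · ring

lemma exists_smul_sym2x_eq (hd : d ≠ 0) (P Q : (congruentCurve d).toAffine.Point) :
    ∃ c : ℚ, c ≠ 0 ∧ c • (P + Q).sym2x (P - Q) =
      fun i ↦ (addSubMap (congruentCurve d) i).eval (P.sym2x Q) := by
  by_cases hPQ : P = Q
  · subst hPQ
    rw [sub_self]
    exact exists_smul_sym2x_eq_self hd P
  by_cases hPQ' : P = -Q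
  · subst hPQ'
    obtain ⟨c, hc, h⟩ := exists_smul_sym2x_eq_self hd (-Q)
    refine ⟨c, hc, ?_⟩
    rw [neg_add_cancel, Affine.Point.sym2x_comm, sub_eq_add_neg, h, Affine.Point.sym2x_neg_right]
  rw [addSubMap_eval]
  rcases P with _ | ⟨x₁, y₁, h₁⟩
  · rcases Q with _ | ⟨x₂, y₂, h₂⟩
    · exact absurd rfl hPQ
    · refine ⟨1, one_ne_zero, ?_⟩
      rw [← Affine.Point.zero_def, zero_add, zero_sub, Affine.Point.sym2x_neg_right]
      ext i
      fin_cases i <;> simp <;> ring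
  · rcases Q with _ | ⟨x₂, y₂, h₂⟩
    · refine ⟨1, one_ne_zero, ?_⟩
      rw [← Affine.Point.zero_def, add_zero, sub_zero]
      ext i
      fin_cases i <;> simp <;> ring
    · have hx : x₁ ≠ x₂ := fun hx ↦ (Affine.Point.X_eq_iff (h₁ := h₁) (h₂ := h₂)).mp hx |>.elim
        hPQ hPQ'
      have e₁ := (nonsingular_iff hd).mp h₁
      have e₂ := (nonsingular_iff hd).mp h₂
      obtain ⟨h, key⟩ := exists_add_some_of_X_ne hx h₁ h₂
      obtain ⟨h', key'⟩ := exists_add_some_of_X_ne hx h₁ ((Affine.nonsingular_neg ..).mpr h₂)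
      rw [sub_eq_add_neg, Affine.Point.neg_some, key, key']
      have hx' : x₁ - x₂ ≠ 0 := sub_ne_zero.mpr hx
      refine ⟨(x₁ - x₂) ^ 2, by positivity, ?_⟩
      simp only [negY_eq]
      ext i
      fin_cases i <;> simp
      · field_simp
        linear_combination
          (y₁ ^ 2 + x₁ ^ 3 - d ^ 2 * x₁ - 2 * y₂ ^ 2 - 2 * (x₁ + x₂) * (x₁ - x₂) ^ 2) * e₁ +
          (y₂ ^ 2 + x₂ ^ 3 - d ^ 2 * x₂ - 2 * (x₁ ^ 3 - d ^ 2 * x₁) -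
            2 * (x₁ + x₂) * (x₁ - x₂) ^ 2) * e₂
      · field_simp
        linear_combination 2 * e₁ + 2 * e₂
      · ring

/-- The naive logarithmic height of a point: the height of its `x`-coordinate. -/
noncomputable def height (P : (congruentCurve d).toAffine.Point) : ℝ := logHeight P.xRep

instance : Northcott (height (d := d)) where
  finite_le B := by
    refine Set.Finite.of_finite_fibers Affine.Point.xRep ?_ fun v _ ↦ ?_
    · refine (((NumberField.finite_setOfPred_logHeight₁_le ℚ B).image fun x ↦ ![x, 1]).union
        (Set.finite_singleton ![1, 0])).subset ?_
      rintro _ ⟨P, hP, rfl⟩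
      rcases P with _ | ⟨x, y, h⟩
      · right
        simp [← Affine.Point.zero_def]
      · left
        refine ⟨x, ?_, by simp⟩
        simpa [height, logHeight₁_eq_logHeight] using hP
    · by_cases h : ∃ P : (congruentCurve d).toAffine.Point, P.xRep = v
      · obtain ⟨P, rfl⟩ := h
        refine (Set.toFinite {P, -P}).subset ?_
        rintro Q ⟨-, hQ⟩
        exact Affine.Point.eq_or_eq_neg_of_xRep_eq_xRep hQ
      · refine Set.finite_empty.subset ?_
        rintro Q ⟨-, hQ⟩
        exact h ⟨Q, hQ⟩

lemma exists_abs_height_le (hd : d ≠ 0) :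
    ∃ C, ∀ P Q : (congruentCurve d).toAffine.Point,
      |height (P + Q) + height (P - Q) - 2 * (height P + height Q)| ≤ C := by
  have := isElliptic hd
  obtain ⟨C₁, h₁⟩ := abs_logHeight_addSubMap_sub_two_mul_logHeight_le (congruentCurve d)
  obtain ⟨C₂, h₂⟩ := abs_logHeight_sym2_sub_le ℚ
  have h₃ (P Q : (congruentCurve d).toAffine.Point) :
      |logHeight (P.sym2x Q) - (height P + height Q)| ≤ C₂ := by
    have hv (R : (congruentCurve d).toAffine.Point) : R.xRep = ![R.xRep 0, R.xRep 1] := by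
      ext i; fin_cases i <;> rfl
    have hP := P.xRep_ne_zero
    have hQ := Q.xRep_ne_zero
    rw [hv] at hP hQ
    have := h₂ hP hQ
    rwa [← hv, ← hv] at this
  refine ⟨C₁ + 3 * C₂, fun P Q ↦ ?_⟩
  obtain ⟨c, hc, h⟩ := exists_smul_sym2x_eq hd P Q
  have h₄ := h₁ (P.sym2x Q)
  rw [← h, logHeight_smul_eq_logHeight _ hc] at h₄
  have h₅ := h₃ P Q
  have h₆ := h₃ (P + Q) (P - Q)
  rw [abs_le] at *
  constructor <;> linarith [h₄.1, h₄.2, h₅.1, h₅.2, h₆.1, h₆.2]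


/-! ### Two-descent -/

/-- The function `P ↦ x(P) - e` representing the two-descent map at the root `e` of `x³ - d²x`,
with its usual values at the point at infinity and at `(e, 0)`. -/
noncomputable def xSub (d e : ℚ) : (congruentCurve d).toAffine.Point → ℚ
  | .zero => 1
  | .some x _ _ => if x = e then 3 * e ^ 2 - d ^ 2 else x - e

variable {e : ℚ}

@[simp]
lemma xSub_zero : xSub d e 0 = 1 := rfl

lemma xSub_some_of_eq {y : ℚ} (h : (congruentCurve d).toAffine.Nonsingular e y) :
    xSub d e (.some e y h) = 3 * e ^ 2 - d ^ 2 := if_pos rfl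

lemma xSub_some_of_ne {x y : ℚ} (hx : x ≠ e) (h : (congruentCurve d).toAffine.Nonsingular x y) :
    xSub d e (.some x y h) = x - e := if_neg hx

lemma xSub_neg (P : (congruentCurve d).toAffine.Point) : xSub d e (-P) = xSub d e P := by
  cases P <;> rfl

lemma deriv_ne_zero (hd : d ≠ 0) (he : e ^ 3 = d ^ 2 * e) : 3 * e ^ 2 - d ^ 2 ≠ 0 := by
  intro h
  have h₁ : e ^ 3 = 0 := by linear_combination (-1 / 2) * he + e / 2 * h
  have h₂ : e = 0 := by simpa using h₁
  exact hd (by simpa [h₂] using h)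

lemma xSub_ne_zero (hd : d ≠ 0) (he : e ^ 3 = d ^ 2 * e) (P : (congruentCurve d).toAffine.Point) :
    xSub d e P ≠ 0 := by
  rcases P with _ | ⟨x, y, h⟩
  · exact one_ne_zero
  · by_cases hx : x = e
    · subst hx
      rw [xSub_some_of_eq]
      exact deriv_ne_zero hd he
    · rw [xSub_some_of_ne hx]
      exact sub_ne_zero.mpr hx

lemma isSquare_xSub_mul_of_eq (hd : d ≠ 0) (he : e ^ 3 = d ^ 2 * e) {y : ℚ}
    (h : (congruentCurve d).toAffine.Nonsingular e y) (Q : (congruentCurve d).toAffine.Point) :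
    IsSquare (xSub d e (.some e y h) * xSub d e Q * xSub d e (.some e y h + Q)) := by
  have hy : y = 0 := by
    have := (nonsingular_iff hd).mp h
    simpa [he] using this
  subst hy
  rcases Q with _ | ⟨x₂, y₂, h₂⟩
  · rw [← Affine.Point.zero_def, add_zero, xSub_zero, mul_one]
    exact ⟨_, rfl⟩
  have e₂ := (nonsingular_iff hd).mp h₂
  by_cases hx : e = x₂
  · subst hx
    have hy₂ : y₂ = 0 := by simpa [he] using e₂
    subst hy₂
    rw [Affine.Point.add_self_of_Y_eq (by rw [negY_eq, neg_zero]), xSub_zero, mul_one]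
    exact ⟨_, rfl⟩
  · obtain ⟨h₃, key⟩ := exists_add_some_of_X_ne hx h h₂
    have hx' : e - x₂ ≠ 0 := sub_ne_zero.mpr hx
    have hx'' : x₂ - e ≠ 0 := sub_ne_zero.mpr (Ne.symm hx)
    have hs : (x₂ - e) * (((0 - y₂) / (e - x₂)) ^ 2 - e - x₂ - e) = 3 * e ^ 2 - d ^ 2 := by
      obtain ⟨m, hm⟩ : ∃ m, m = (0 - y₂) / (e - x₂) := ⟨_, rfl⟩
      rw [← hm]
      rw [eq_div_iff hx'] at hm
      obtain rfl : y₂ = m * (x₂ - e) := by linear_combination hm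
      exact mul_left_cancel₀ hx'' (by linear_combination e₂ + he)
    have hne : ((0 - y₂) / (e - x₂)) ^ 2 - e - x₂ ≠ e := by
      intro h
      rw [h, sub_self, mul_zero] at hs
      exact deriv_ne_zero hd he hs.symm
    rw [key, xSub_some_of_eq, xSub_some_of_ne (Ne.symm hx), xSub_some_of_ne hne, mul_assoc, hs]
    exact ⟨_, rfl⟩

lemma isSquare_xSub_mul (hd : d ≠ 0) (he : e ^ 3 = d ^ 2 * e)
    (P Q : (congruentCurve d).toAffine.Point) :
    IsSquare (xSub d e P * xSub d e Q * xSub d e (P + Q)) := by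
  rcases P with _ | ⟨x₁, y₁, h₁⟩
  · rw [← Affine.Point.zero_def, zero_add, xSub_zero, one_mul]
    exact ⟨_, rfl⟩
  rcases Q with _ | ⟨x₂, y₂, h₂⟩
  · rw [← Affine.Point.zero_def, add_zero, xSub_zero, mul_one]
    exact ⟨_, rfl⟩
  by_cases hx₁ : x₁ = e
  · subst hx₁
    exact isSquare_xSub_mul_of_eq hd he h₁ _
  by_cases hx₂ : x₂ = e
  · subst hx₂
    rw [add_comm, mul_comm (xSub _ _ _) (xSub _ _ _)]
    exact isSquare_xSub_mul_of_eq hd he h₂ _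
  have e₁ := (nonsingular_iff hd).mp h₁
  have e₂ := (nonsingular_iff hd).mp h₂
  rcases hR : Affine.Point.some x₁ y₁ h₁ + Affine.Point.some x₂ y₂ h₂ with _ | ⟨x₃, y₃, h₃⟩
  · rw [eq_neg_of_add_eq_zero_left hR, xSub_neg, ← Affine.Point.zero_def, xSub_zero, mul_one]
    exact ⟨_, rfl⟩
  by_cases hx₃ : x₃ = e
  · subst hx₃
    have := isSquare_xSub_mul_of_eq hd he h₃ (-Affine.Point.some x₁ y₁ h₁)
    rw [← hR, add_neg_cancel_comm, xSub_neg, hR] at this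
    convert this using 1
    ring
  rw [xSub_some_of_ne hx₁, xSub_some_of_ne hx₂, xSub_some_of_ne hx₃]
  by_cases hx : x₁ = x₂
  · subst hx
    have hy : y₁ = y₂ := by
      rcases Affine.Y_eq_of_X_eq h₁.1 h₂.1 rfl with h | h
      · exact h
      · rw [Affine.Point.add_of_Y_eq rfl h] at hR
        exact absurd hR.symm (Affine.Point.some_ne_zero _)
    subst hy
    have hy : y₁ ≠ 0 := by
      rintro rfl
      rw [Affine.Point.add_self_of_Y_eq (by rw [negY_eq, neg_zero])] at hR
      exact absurd hR.symm (Affine.Point.some_ne_zero _)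
    obtain ⟨h₄, key⟩ := exists_add_self_some hy h₁
    rw [hR, Affine.Point.some.injEq] at key
    refine ⟨y₁ + (3 * x₁ ^ 2 - d ^ 2) / (2 * y₁) * (e - x₁), ?_⟩
    rw [key.1]
    obtain ⟨m, hm⟩ : ∃ m, m = (3 * x₁ ^ 2 - d ^ 2) / (2 * y₁) := ⟨_, rfl⟩
    rw [← hm]
    rw [eq_div_iff (by positivity)] at hm
    linear_combination (x₁ - e) * hm - e₁ - he
  · obtain ⟨h₄, key⟩ := exists_add_some_of_X_ne hx h₁ h₂
    rw [hR, Affine.Point.some.injEq] at key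
    refine ⟨y₁ + (y₁ - y₂) / (x₁ - x₂) * (e - x₁), ?_⟩
    rw [key.1]
    have hx' : x₁ - x₂ ≠ 0 := sub_ne_zero.mpr hx
    obtain ⟨m, hm⟩ : ∃ m, m = (y₁ - y₂) / (x₁ - x₂) := ⟨_, rfl⟩
    rw [← hm]
    rw [eq_div_iff hx'] at hm
    have hk : m * (2 * y₁ - m * (x₁ - x₂)) = x₁ ^ 2 + x₁ * x₂ + x₂ ^ 2 - d ^ 2 := by
      obtain rfl : y₂ = y₁ - m * (x₁ - x₂) := by linear_combination hm
      exact mul_left_cancel₀ hx' (by linear_combination e₁ - e₂)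
    linear_combination (x₁ - e) * hk - e₁ - he

/-- A point with `x` and `x + d` nonzero squares is divisible by two. -/
lemma exists_two_nsmul_eq (hd : d ≠ 0) {x y : ℚ} (h : (congruentCurve d).toAffine.Nonsingular x y)
    (hx : x ≠ 0) (hxd : x + d ≠ 0) (hsq : IsSquare x) (hsqd : IsSquare (x + d)) :
    ∃ Q : (congruentCurve d).toAffine.Point, 2 • Q = .some x y h := by
  have he := (nonsingular_iff hd).mp h
  obtain ⟨a, ha⟩ := hsq
  obtain ⟨b, hb⟩ := hsqd
  have ha₀ : a ≠ 0 := by rintro rfl; simp [ha] at hx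
  have hb₀ : b ≠ 0 := by rintro rfl; simp [hb] at hxd
  obtain ⟨c, hc⟩ : ∃ c, y = a * b * c := ⟨y / (a * b), by field_simp⟩
  have hc' : c * c = x - d := by
    have h₁ : (a * a) * (b * b) * (c * c) = (a * a) * (b * b) * (x - d) := by
      rw [← ha, ← hb]
      linear_combination he - (y + a * b * c) * hc + c ^ 2 * (a * a * hb + (x + d) * ha)
    exact mul_left_cancel₀ (by positivity) h₁
  have hab : a + b ≠ 0 := fun h₁ ↦ hd (by linear_combination hb - ha + (b - a) * h₁)
  have hac : a + c ≠ 0 := fun h₁ ↦ hd (by linear_combination hc' + ha + (a - c) * h₁)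
  have hbc : b + c ≠ 0 := fun h₁ ↦ hd (by
    linear_combination (1 / 2) * hb + (1 / 2) * hc' + (1 / 2) * (b - c) * h₁)
  have hd₁ : d = b * b - a * a := by linear_combination hb - ha
  have hd₂ : c * c = 2 * (a * a) - b * b := by linear_combination hc' + 2 * ha - hb
  have hQ : (congruentCurve d).toAffine.Nonsingular (a * a + a * b + a * c + b * c)
      ((a + b) * (a + c) * (b + c)) := by
    rw [nonsingular_iff hd, hd₁]
    have h₁ : a * a + a * b + a * c + b * c = (a + b) * (a + c) := by ring
    have h₂ : (a + b) * (a + c) + (b * b - a * a) = (a + b) * (b + c) := by ring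
    have h₃ : (a + b) * (a + c) - (b * b - a * a) = (a + c) * (b + c) := by
      linear_combination -hd₂
    rw [h₁]
    linear_combination (-((a + b) * (a + c)) * ((a + b) * (a + c) - (b * b - a * a))) * h₂ -
      ((a + b) * (a + c)) * ((a + b) * (b + c)) * h₃
  obtain ⟨h', key⟩ := exists_add_self_some (by positivity) hQ
  refine ⟨_, (two_nsmul _).trans (key.trans ?_)⟩
  have hs : (3 * (a * a + a * b + a * c + b * c) ^ 2 - d ^ 2) /
      (2 * ((a + b) * (a + c) * (b + c))) = a + b + c := by
    rw [div_eq_iff (by positivity), hd₁]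
    linear_combination -(2 * (a * a + a * b + a * c + b * c) + (b * b - a * a)) * hd₂
  rw [Affine.Point.some.injEq, hs]
  constructor
  · linear_combination hd₂ - ha
  · linear_combination -hc - (a + b + c) * hd₂

end congruentCurve

/-! ### Parities of valuations -/

lemma Nat.isSquare_of_even_factorization {n : ℕ} (h : ∀ p, p.Prime → Even (n.factorization p)) :
    IsSquare n := by
  rcases eq_or_ne n 0 with rfl | hn
  · exact IsSquare.zero
  · rw [← Nat.prod_factorization_pow_eq_self hn]
    exact Finset.isSquare_prod _ fun p hp ↦
      (h p (Nat.prime_of_mem_primeFactors hp)).isSquare_pow p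

lemma Rat.isSquare_of_even_padicValRat {q : ℚ} (hq : 0 < q)
    (h : ∀ p, p.Prime → Even (padicValRat p q)) : IsSquare q := by
  have hnum : q.num.natAbs ≠ 0 := by simpa using hq.ne'
  have hcast : ((q.num.natAbs : ℕ) : ℚ) = q.num := by
    rw [Nat.cast_natAbs, abs_of_nonneg (Rat.num_nonneg.mpr hq.le)]
  obtain ⟨r, hr⟩ : IsSquare (q.num.natAbs * q.den) := by
    refine Nat.isSquare_of_even_factorization fun p hp ↦ ?_
    have := Fact.mk hp
    have h₁ := h p hp
    rw [padicValRat_def, Int.even_sub, padicValInt] at h₁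
    rw [Nat.factorization_mul hnum q.den_nz, Finsupp.add_apply, Nat.even_add,
      Nat.factorization_def _ hp, Nat.factorization_def _ hp]
    exact_mod_cast h₁
  refine ⟨r / q.den, ?_⟩
  have hden : (q.den : ℚ) ≠ 0 := by exact_mod_cast q.den_nz
  have hr' : (q.num : ℚ) * q.den = r * r := by rw [← hcast]; exact_mod_cast hr
  rw [div_mul_div_comm, ← hr', mul_div_mul_right _ _ hden, Rat.num_div_den]

lemma padicValRat.even_of_sq_eq {p : ℕ} [Fact p.Prime] {y u a b : ℚ} (hy : y ≠ 0)
    (h : y ^ 2 = u * (u - a) * (u - b)) (ha : a ≠ 0) (hb : b ≠ 0) (hva : padicValRat p a = 0)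
    (hvb : padicValRat p b = 0) : Even (padicValRat p u) := by
  have hu : u * (u - a) * (u - b) ≠ 0 := h ▸ pow_ne_zero 2 hy
  have hu₀ : u ≠ 0 := left_ne_zero_of_mul (left_ne_zero_of_mul hu)
  have hua : u - a ≠ 0 := right_ne_zero_of_mul (left_ne_zero_of_mul hu)
  have hub : u - b ≠ 0 := right_ne_zero_of_mul hu
  have hv := congrArg (padicValRat p) h
  rw [padicValRat.pow, padicValRat.mul (mul_ne_zero hu₀ hua) hub,
    padicValRat.mul hu₀ hua] at hv
  push_cast at hv
  have hsub : ∀ c, c ≠ 0 → u - c ≠ 0 → padicValRat p c = 0 →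
      (padicValRat p u < 0 → padicValRat p (u - c) = padicValRat p u) ∧
      (0 < padicValRat p u → padicValRat p (u - c) = 0) := by
    intro c hc huc hvc
    refine ⟨fun hlt ↦ ?_, fun hlt ↦ ?_⟩
    · rw [sub_eq_add_neg,
        padicValRat.add_eq_of_lt (by rwa [← sub_eq_add_neg]) hu₀ (neg_ne_zero.mpr hc)]
      rwa [padicValRat.neg, hvc]
    · rw [sub_eq_add_neg, add_comm, padicValRat.add_eq_of_lt
        (by rwa [add_comm, ← sub_eq_add_neg]) (neg_ne_zero.mpr hc) hu₀, padicValRat.neg, hvc]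
      rwa [padicValRat.neg, hvc]
  obtain ⟨ha₁, ha₂⟩ := hsub a ha hua hva
  obtain ⟨hb₁, hb₂⟩ := hsub b hb hub hvb
  rcases lt_trichotomy (padicValRat p u) 0 with hlt | heq | hlt
  · rw [ha₁ hlt, hb₁ hlt] at hv
    exact ⟨padicValRat p y - padicValRat p u, by linarith⟩
  · rw [heq]
    exact Even.zero
  · rw [ha₂ hlt, hb₂ hlt] at hv
    exact ⟨padicValRat p y, by linarith⟩

namespace congruentCurve

variable {d e : ℚ}

lemma even_padicValRat_xSub (hd : d ≠ 0) (he : e ^ 3 = d ^ 2 * e) {a b : ℚ}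
    (hadd : a + b = -3 * e) (hmul : a * b = 3 * e ^ 2 - d ^ 2) {p : ℕ} [Fact p.Prime]
    (hva : padicValRat p a = 0) (hvb : padicValRat p b = 0)
    (P : (congruentCurve d).toAffine.Point) : Even (padicValRat p (xSub d e P)) := by
  have hab : a * b ≠ 0 := hmul ▸ deriv_ne_zero hd he
  have ha : a ≠ 0 := left_ne_zero_of_mul hab
  have hb : b ≠ 0 := right_ne_zero_of_mul hab
  rcases P with _ | ⟨x, y, h⟩
  · simp [← Affine.Point.zero_def]
  by_cases hx : x = e
  · subst hx
    rw [xSub_some_of_eq, ← hmul, padicValRat.mul ha hb, hva, hvb]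
    simp
  rw [xSub_some_of_ne hx]
  have h' : y ^ 2 = (x - e) * (x - e - a) * (x - e - b) := by
    linear_combination (nonsingular_iff hd).mp h + he + (x - e) ^ 2 * hadd - (x - e) * hmul
  rcases eq_or_ne y 0 with rfl | hy
  · rw [zero_pow two_ne_zero, eq_comm, mul_eq_zero, mul_eq_zero,
      or_iff_right (sub_ne_zero.mpr hx), sub_eq_zero, sub_eq_zero] at h'
    rcases h' with h' | h' <;> simp [h', hva, hvb]
  · exact padicValRat.even_of_sq_eq hy h' ha hb hva hvb

lemma xSub_neg_pos (hd : 0 < d) (P : (congruentCurve d).toAffine.Point) : 0 < xSub d (-d) P := by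
  rcases P with _ | ⟨x, y, h⟩
  · exact one_pos
  by_cases hx : x = -d
  · subst hx
    rw [xSub_some_of_eq]
    nlinarith
  · rw [xSub_some_of_ne hx]
    have h' := (nonsingular_iff hd.ne').mp h
    by_contra! hlt
    have hlt' : x < -d := lt_of_le_of_ne (by linarith) hx
    have : 0 < (-x - d) * ((d - x) * (-x)) := by
      refine mul_pos (by linarith) (mul_pos (by linarith) (by linarith))
    nlinarith [sq_nonneg y]

/-- A character modulo squares induces a homomorphism on the group of points. -/
noncomputable def xSubHom (hd : d ≠ 0) (he : e ^ 3 = d ^ 2 * e) (φ : ℚ → ZMod 2)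
    (hφ : ∀ a b, a ≠ 0 → b ≠ 0 → φ (a * b) = φ a + φ b) :
    (congruentCurve d).toAffine.Point →+ ZMod 2 :=
  AddMonoidHom.mk' (fun P ↦ φ (xSub d e P)) fun P Q ↦ by
    obtain ⟨r, hr⟩ := isSquare_xSub_mul hd he P Q
    have hP := xSub_ne_zero hd he P
    have hQ := xSub_ne_zero hd he Q
    have hPQ := xSub_ne_zero hd he (P + Q)
    have hr₀ : r ≠ 0 := by
      rintro rfl
      simp_all
    have h := congrArg φ hr
    rw [hφ _ _ (mul_ne_zero hP hQ) hPQ, hφ _ _ hP hQ, hφ _ _ hr₀ hr₀, CharTwo.add_self_eq_zero] at h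
    rw [← CharTwo.sub_eq_add, sub_eq_zero] at h
    exact h.symm

/-- The sign of a rational number, as a character. -/
noncomputable def signChar (a : ℚ) : ZMod 2 := if a < 0 then 1 else 0

lemma signChar_mul (a b : ℚ) (ha : a ≠ 0) (hb : b ≠ 0) :
    signChar (a * b) = signChar a + signChar b := by
  rcases ha.lt_or_gt with ha | ha <;> rcases hb.lt_or_gt with hb | hb
  · simp [signChar, ha, hb, (mul_pos_of_neg_of_neg ha hb).le, CharTwo.add_self_eq_zero]
  · simp [signChar, ha, hb.le, mul_neg_of_neg_of_pos ha hb]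
  · simp [signChar, ha.le, hb, mul_neg_of_pos_of_neg ha hb]
  · simp [signChar, ha.not_gt, hb.not_gt, (mul_pos ha hb).not_gt]

lemma padicValRat_char_mul (p : ℕ) [Fact p.Prime] (a b : ℚ) (ha : a ≠ 0) (hb : b ≠ 0) :
    ((padicValRat p (a * b) : ℤ) : ZMod 2) = (padicValRat p a : ℤ) + (padicValRat p b : ℤ) := by
  rw [padicValRat.mul ha hb, Int.cast_add]

/-- The two-descent homomorphism, recording the sign of `x`, the parities of the valuations of `x`
at the primes dividing `n`, and those of `x + n` at the primes dividing `2 * n`. -/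
noncomputable def descentHom {n : ℕ} (hn : (n : ℚ) ≠ 0) : (congruentCurve n).toAffine.Point →+
    ZMod 2 × (n.primeFactors → ZMod 2) × ((2 * n).primeFactors → ZMod 2) :=
  (xSubHom hn (e := 0) (by ring) signChar signChar_mul).prod
    ((AddMonoidHom.pi fun p : n.primeFactors ↦ have := Fact.mk (Nat.prime_of_mem_primeFactors p.2)
      xSubHom hn (e := 0) (by ring) (fun a ↦ ((padicValRat p a : ℤ) : ZMod 2))
        (padicValRat_char_mul p)).prod
    (AddMonoidHom.pi fun p : (2 * n).primeFactors ↦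
      have := Fact.mk (Nat.prime_of_mem_primeFactors p.2)
      xSubHom hn (e := -n) (by ring) (fun a ↦ ((padicValRat p a : ℤ) : ZMod 2))
        (padicValRat_char_mul p)))

lemma descentHom_eq_zero_iff {n : ℕ} (hn : (n : ℚ) ≠ 0) (P : (congruentCurve n).toAffine.Point) :
    descentHom hn P = 0 ↔ 0 ≤ xSub n 0 P ∧ (∀ p ∈ n.primeFactors, Even (padicValRat p (xSub n 0 P)))
      ∧ ∀ p ∈ (2 * n).primeFactors, Even (padicValRat p (xSub n (-n) P)) := by
  simp only [descentHom, xSubHom, signChar, Prod.ext_iff, funext_iff, AddMonoidHom.prod_apply,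
    AddMonoidHom.pi_apply, AddMonoidHom.mk'_apply, Prod.fst_zero, Prod.snd_zero, Pi.zero_apply,
    ZMod.intCast_eq_zero_iff_even, Subtype.forall, ite_eq_right_iff, one_ne_zero, imp_false, not_lt]

lemma ker_descentHom_le {n : ℕ} (hn : (n : ℚ) ≠ 0) : (descentHom hn).ker ≤
    (nsmulAddMonoidHom 2 : (congruentCurve n).toAffine.Point →+ _).range := by
  intro P hP
  have hn₀ : n ≠ 0 := by exact_mod_cast hn
  have hpos : (0 : ℚ) < n := by positivity
  rw [AddMonoidHom.mem_ker, descentHom_eq_zero_iff] at hP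
  obtain ⟨h₀, h₁, h₂⟩ := hP
  have hv : ∀ p m : ℕ, p.Prime → p ∉ m.primeFactors → m ≠ 0 → padicValRat p m = 0 := by
    intro p m hp hpm hm
    rw [padicValRat.of_nat, padicValNat.eq_zero_of_not_dvd]
    · rfl
    · exact fun hdvd ↦ hpm (Nat.mem_primeFactors.mpr ⟨hp, hdvd, hm⟩)
  have hsq₀ : IsSquare (xSub n 0 P) := by
    refine Rat.isSquare_of_even_padicValRat
      (h₀.lt_of_ne (xSub_ne_zero hn (by ring) P).symm) fun p hp ↦ ?_
    have := Fact.mk hp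
    by_cases hpn : p ∈ n.primeFactors
    · exact h₁ p hpn
    · have hvn := hv p n hp hpn hn₀
      exact even_padicValRat_xSub hn (a := n) (b := -n) (by ring) (by ring) (by ring) hvn
        (by rw [padicValRat.neg, hvn]) P
  have hsqn : IsSquare (xSub n (-n) P) := by
    refine Rat.isSquare_of_even_padicValRat (xSub_neg_pos hpos P) fun p hp ↦ ?_
    have := Fact.mk hp
    by_cases hpn : p ∈ (2 * n).primeFactors
    · exact h₂ p hpn
    · have hvn := hv p n hp
        (fun h ↦ hpn (Nat.primeFactors_mono (Dvd.intro_left 2 rfl) (by positivity) h)) hn₀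
      have hv2n := hv p (2 * n) hp hpn (by positivity)
      exact even_padicValRat_xSub hn (a := n) (b := (2 * n : ℕ)) (by ring) (by push_cast; ring)
        (by push_cast; ring) hvn hv2n P
  rcases P with _ | ⟨x, y, h⟩
  · exact zero_mem _
  have hx : x ≠ 0 := by
    rintro rfl
    rw [xSub_some_of_eq] at h₀
    nlinarith
  have hxn : x ≠ -n := by
    rintro rfl
    rw [xSub_some_of_ne hx] at h₀
    linarith
  rw [xSub_some_of_ne hx, sub_zero] at hsq₀
  rw [xSub_some_of_ne hxn, sub_neg_eq_add] at hsqn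
  exact exists_two_nsmul_eq hn h hx (by rwa [ne_eq, add_eq_zero_iff_eq_neg]) hsq₀ hsqn

lemma fg (hn : d ≠ 0) {V : Type*} [AddCommGroup V] [Finite V]
    (f : (congruentCurve d).toAffine.Point →+ V)
    (hf : f.ker ≤ (nsmulAddMonoidHom 2 : (congruentCurve d).toAffine.Point →+ _).range) :
    AddGroup.FG (congruentCurve d).toAffine.Point := by
  obtain ⟨C, hC⟩ := exists_abs_height_le hn
  have hfin : f.ker.FiniteIndex := inferInstance
  have := AddSubgroup.finiteIndex_of_le hf
  refine AddCommGroup.fg_of_descent' (h := height (d := d)) this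
    (fun P ↦ Height.logHeight_nonneg _) hC

lemma exists_injective_two_nsmul_eq_zero (hd : d ≠ 0) :
    ∃ t : Fin 4 → (congruentCurve d).toAffine.Point, Function.Injective t ∧ ∀ i, 2 • t i = 0 := by
  have h : ∀ x ∈ ({0, d, -d} : Set ℚ), (congruentCurve d).toAffine.Nonsingular x 0 := by
    rintro x (rfl | rfl | rfl) <;> rw [nonsingular_iff hd] <;> ring
  refine ⟨![0, .some 0 0 (h 0 (by simp)), .some d 0 (h d (by simp)),
    .some (-d) 0 (h (-d) (by simp))], ?_, ?_⟩
  · intro i j hij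
    have hd' : d ≠ -d := fun h ↦ hd (by linarith)
    have hd'' : -d ≠ d := hd'.symm
    have hne : ∀ x h, (0 : (congruentCurve d).toAffine.Point) ≠ .some x 0 h :=
      fun _ _ ↦ (Affine.Point.some_ne_zero _).symm
    fin_cases i <;> fin_cases j <;> first
      | rfl
      | (exfalso; revert hij; simp [hne, hd, hd.symm, hd', hd''])
  · intro i
    rw [two_nsmul]
    fin_cases i
    · exact add_zero _
    all_goals exact Affine.Point.add_self_of_Y_eq (by rw [negY_eq, neg_zero])

theorem rank_le {n : ℕ} (hn : Squarefree n) :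
    Module.rank ℤ (congruentCurve n).toAffine.Point ≤
      (2 * n.primeFactors.card - padicValNat 2 n : ℕ) := by
  have hn₀ : n ≠ 0 := hn.ne_zero
  have hn' : (n : ℚ) ≠ 0 := by exact_mod_cast hn₀
  obtain ⟨t, ht, ht₂⟩ := exists_injective_two_nsmul_eq_zero hn'
  have := fg hn' _ (ker_descentHom_le hn')
  have hcard := AddCommGroup.rank_add_two_le_of_card_le (descentHom hn')
    (n := 1 + (n.primeFactors.card + (2 * n).primeFactors.card))
    (by simp only [Nat.card_prod, Nat.card_pi, Nat.card_zmod, Finset.prod_const, Finset.card_univ,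
      Fintype.card_coe, pow_add, pow_one, le_refl]) (ker_descentHom_le hn') ht ht₂
  have hcount : (2 * n).primeFactors.card + padicValNat 2 n = n.primeFactors.card + 1 := by
    by_cases h2 : 2 ∣ n
    · have h₁ : padicValNat 2 n = 1 := by
        rw [← Nat.factorization_def _ Nat.prime_two,
          Nat.factorization_eq_one_of_squarefree hn Nat.prime_two h2]
      rw [h₁, Nat.primeFactors_mul two_ne_zero hn₀, Nat.prime_two.primeFactors,
        Finset.union_eq_right.mpr (by simp [h2, hn₀, Nat.prime_two])]
    · rw [padicValNat.eq_zero_of_not_dvd h2, Nat.primeFactors_mul two_ne_zero hn₀,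
        Nat.prime_two.primeFactors, Finset.singleton_union,
        Finset.card_insert_of_notMem (by simp [h2])]
  convert hcard using 2
  omega

end congruentCurve

/-- For a nonzero squarefree integer `D`, the rank of the group of rational points of the
elliptic curve `y² = x³ − D²x` is at most `2·ω(D) − ν₂(D)`. -/
theorem rank_le_of_congruent_number_curve (D : ℤ) (hD : D ≠ 0) (hsf : Squarefree D) :
    Module.rank ℤ
        (({ a₁ := 0, a₂ := 0, a₃ := 0, a₄ := -(D : ℚ) ^ 2, a₆ := 0 } :
          WeierstrassCurve ℚ).toAffine.Point) ≤
      ((2 * D.natAbs.primeFactors.card - padicValInt 2 D : ℕ) : Cardinal) := by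
  have h : (D : ℚ) ^ 2 = (D.natAbs : ℚ) ^ 2 := by
    rw [Nat.cast_natAbs, Int.cast_abs, sq_abs]
  rw [h]
  exact congruentCurve.rank_le (Int.squarefree_natAbs.mpr hsf)
end

section
/- Let d be an odd squarefree integer, let q be an odd prime not dividing d, and let E : y² = x³ − dx over the finite field F_q. Set a_q = q + 1 − #E(F_q), and define the sequence u₀ = 1, u₁ = a_q, u_{k+1} = a_q·u_k − q·u_{k−1}. Then for every odd positive integer m: if d is a square in F_q then u_m is even, and if d is not a square in F_q then 4 divides u_m. -/
/-- An even function on `ZMod (2 * h + 1)` vanishing at `0` sums to twice its sum over a half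
range. -/
theorem sum_zmod_eq_two_mul_sum_range (h : ℕ) (g : ZMod (2 * h + 1) → ℤ)
    (hg0 : g 0 = 0) (hg : ∀ x, g (-x) = g x) :
    ∑ x, g x = 2 * ∑ i ∈ Finset.range h, g ((i + 1 : ℕ) : ZMod (2 * h + 1)) := by
  have hsum : ∑ x, g x = ∑ i ∈ Finset.range (2 * h + 1), g (i : ZMod (2 * h + 1)) := by
    rw [Finset.sum_range]
    refine Finset.sum_congr rfl fun x _ => ?_
    congr 1
    exact (ZMod.natCast_zmod_val (n := 2 * h + 1) x).symm
  have hfold : ∑ i ∈ Finset.range h, g ((h + i + 1 : ℕ) : ZMod (2 * h + 1)) =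
      ∑ i ∈ Finset.range h, g ((i + 1 : ℕ) : ZMod (2 * h + 1)) := by
    rw [← Finset.sum_range_reflect]
    refine Finset.sum_congr rfl fun i hi => ?_
    have hi' := Finset.mem_range.mp hi
    rw [← hg]
    congr 1
    rw [neg_eq_iff_add_eq_zero, ← Nat.cast_add,
      show h + (h - 1 - i) + 1 + (i + 1) = 2 * h + 1 by omega, ZMod.natCast_self]
  rw [hsum, Finset.sum_range_succ', Nat.cast_zero, hg0, add_zero,
    show Finset.range (2 * h) = Finset.range (h + h) by rw [two_mul], Finset.sum_range_add, hfold]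
  exact (two_mul _).symm

/-- The number of points of `y² = x³ - c x` as a quadratic character sum. -/
theorem card_point_eq_add_sum_quadraticChar {F : Type*} [Field F] [Fintype F] [DecidableEq F]
    (hF : ringChar F ≠ 2) (c : F) (hc : c ≠ 0) :
    (Nat.card (({ a₁ := 0, a₂ := 0, a₃ := 0, a₄ := -c, a₆ := 0 } :
      WeierstrassCurve F).toAffine.Point) : ℤ) =
      Fintype.card F + 1 + ∑ x : F, quadraticChar F (x ^ 3 - c * x) := by
  set W : WeierstrassCurve F := { a₁ := 0, a₂ := 0, a₃ := 0, a₄ := -c, a₆ := 0 } with hW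
  have h2 : (2 : F) ≠ 0 := Ring.two_ne_zero hF
  have hΔ : W.Δ ≠ 0 := by
    have : W.Δ = 2 ^ 6 * c ^ 3 := by
      simp only [hW, WeierstrassCurve.Δ, WeierstrassCurve.b₂, WeierstrassCurve.b₄,
        WeierstrassCurve.b₆, WeierstrassCurve.b₈]
      ring
    rw [this]
    exact mul_ne_zero (pow_ne_zero _ h2) (pow_ne_zero _ hc)
  have heqn : ∀ x y : F, W.toAffine.Nonsingular x y ↔ y ^ 2 = x ^ 3 - c * x := by
    intro x y
    rw [← WeierstrassCurve.Affine.equation_iff_nonsingular_of_Δ_ne_zero hΔ,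
      WeierstrassCurve.Affine.equation_iff]
    simp [hW, sub_eq_add_neg]
  have hcard : Nat.card W.toAffine.Point =
      Nat.card {xy : F × F // xy.2 ^ 2 = xy.1 ^ 3 - c * xy.1} + 1 := by
    rw [← Finite.card_option]
    exact Nat.card_congr ((WeierstrassCurve.Affine.nonsingularPointEquiv W.toAffine).trans
      (Equiv.subtypeEquivRight fun xy : F × F => heqn xy.1 xy.2).optionCongr)
  have hfib : Nat.card {xy : F × F // xy.2 ^ 2 = xy.1 ^ 3 - c * xy.1} =
      ∑ x : F, Nat.card {y : F // y ^ 2 = x ^ 3 - c * x} := by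
    rw [← Nat.card_sigma]
    exact Nat.card_congr
      (Equiv.subtypeProdEquivSigmaSubtype fun x y : F => y ^ 2 = x ^ 3 - c * x)
  have hsqrt : ∀ x : F, (Nat.card {y : F // y ^ 2 = x ^ 3 - c * x} : ℤ) =
      quadraticChar F (x ^ 3 - c * x) + 1 := by
    intro x
    rw [← quadraticChar_card_sqrts hF, Set.toFinset_card, Nat.card_eq_fintype_card]
    rfl
  rw [hcard, hfib]
  push_cast
  simp only [hsqrt, Finset.sum_add_distrib]
  simp
  ring

/-- The character sum of `x³ - c x` over `ZMod q` is even, and divisible by `4` if `c` is not a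
square. -/
theorem two_dvd_and_four_dvd_sum_quadraticChar (q : ℕ) [Fact q.Prime] (hq : Odd q) (c : ZMod q) :
    2 ∣ ∑ x : ZMod q, quadraticChar (ZMod q) (x ^ 3 - c * x) ∧
      (¬ IsSquare c → 4 ∣ ∑ x : ZMod q, quadraticChar (ZMod q) (x ^ 3 - c * x)) := by
  have hodd : ∀ x : ZMod q, quadraticChar (ZMod q) ((-x) ^ 3 - c * (-x)) =
      quadraticChar (ZMod q) (-1) * quadraticChar (ZMod q) (x ^ 3 - c * x) := by
    intro x
    rw [← map_mul]
    ring_nf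
  by_cases h1 : IsSquare (-1 : ZMod q)
  · have hmod : q % 4 ≠ 3 := by
      simpa using (FiniteField.isSquare_neg_one_iff (F := ZMod q)).mp h1
    have hχ : quadraticChar (ZMod q) (-1) = 1 :=
      (quadraticChar_one_iff_isSquare (by simp)).mpr h1
    obtain ⟨h, rfl⟩ := hq
    rw [sum_zmod_eq_two_mul_sum_range h _ (by simp) fun x => by rw [hodd, hχ, one_mul]]
    refine ⟨dvd_mul_right _ _, fun hc => ?_⟩
    refine mul_dvd_mul_left (2 : ℤ) (b := 2) ?_
    have heven : Even h := by
      rw [Nat.even_iff]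
      omega
    rw [← sub_add_cancel (∑ i ∈ Finset.range h, _) (h : ℤ)]
    refine dvd_add ?_ (by exact_mod_cast heven.two_dvd)
    rw [show (h : ℤ) = ∑ i ∈ Finset.range h, 1 by simp, ← Finset.sum_sub_distrib]
    refine Finset.dvd_sum fun i hi => ?_
    have hi' := Finset.mem_range.mp hi
    have hx : ((i + 1 : ℕ) : ZMod (2 * h + 1)) ≠ 0 := by
      rw [Ne, ZMod.natCast_eq_zero_iff]
      exact fun hdvd => by have := Nat.le_of_dvd (by omega) hdvd; omega
    generalize ((i + 1 : ℕ) : ZMod (2 * h + 1)) = x at hx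
    have hne : x ^ 3 - c * x ≠ 0 := by
      intro h0
      have h0' : x * (x * x - c) = 0 := by linear_combination h0
      rcases mul_eq_zero.mp h0' with h0 | h0
      · exact hx h0
      · exact hc ⟨x, (sub_eq_zero.mp h0).symm⟩
    rcases quadraticChar_dichotomy hne with h | h <;> rw [h] <;> norm_num
  · have hχ : quadraticChar (ZMod q) (-1) = -1 := quadraticChar_neg_one_iff_not_isSquare.mpr h1
    have hzero : ∑ x : ZMod q, quadraticChar (ZMod q) (x ^ 3 - c * x) = 0 := by
      have hneg := Equiv.sum_comp (Equiv.neg (ZMod q))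
        fun x => quadraticChar (ZMod q) (x ^ 3 - c * x)
      simp only [Equiv.neg_apply, hodd, hχ, ← Finset.mul_sum] at hneg
      linarith
    rw [hzero]
    exact ⟨dvd_zero _, fun _ => dvd_zero _⟩

/-- If `c` divides `u 1`, it divides every odd-indexed term of the recursion. -/
theorem dvd_odd_index_of_recursion {R : Type*} [CommRing R] {a b c : R} {u : ℕ → R}
    (hu1 : u 1 = a) (hurec : ∀ k, u (k + 2) = a * u (k + 1) - b * u k) (hc : c ∣ a) (j : ℕ) :
    c ∣ u (2 * j + 1) := by
  induction j with
  | zero => simpa [hu1] using hc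
  | succ j ih =>
    rw [show 2 * (j + 1) + 1 = 2 * j + 1 + 2 by ring, hurec]
    exact dvd_sub (hc.mul_right _) (ih.mul_left _)


/-- Let `d` be an odd squarefree integer, `q` an odd prime not dividing `d`, and
`a_q = q + 1 − #E(F_q)` for `E : y² = x³ − dx` over `F_q`. If `u` is the sequence
`u₀ = 1`, `u₁ = a_q`, `u_{k+2} = a_q·u_{k+1} − q·u_k`, then for every odd positive `m`:
`u_m` is even when `d` is a square in `F_q`, and `4 ∣ u_m` when `d` is not a square. -/
theorem hecke_sequence_parity (d : ℤ) (hd : Odd d) (hsf : Squarefree d)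
    (q : ℕ) (hq : q.Prime) (hqodd : Odd q) (hqd : ¬ ((q : ℤ) ∣ d))
    (a : ℤ)
    (ha : a = (q : ℤ) + 1 -
      (Nat.card (({ a₁ := 0, a₂ := 0, a₃ := 0, a₄ := -(d : ZMod q), a₆ := 0 } :
        WeierstrassCurve (ZMod q)).toAffine.Point) : ℤ))
    (u : ℕ → ℤ) (hu0 : u 0 = 1) (hu1 : u 1 = a)
    (hurec : ∀ k : ℕ, u (k + 2) = a * u (k + 1) - (q : ℤ) * u k) :
    ∀ m : ℕ, 0 < m → Odd m →
      (IsSquare (d : ZMod q) → Even (u m)) ∧ (¬ IsSquare (d : ZMod q) → (4 : ℤ) ∣ u m) := by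
  have := Fact.mk hq
  have hF : ringChar (ZMod q) ≠ 2 := by
    rw [ZMod.ringChar_zmod_n]
    rintro rfl
    exact absurd hqodd (by decide)
  have hc : (d : ZMod q) ≠ 0 := by rwa [Ne, ZMod.intCast_zmod_eq_zero_iff_dvd]
  have ha' : a = -∑ x : ZMod q, quadraticChar (ZMod q) (x ^ 3 - d * x) := by
    rw [ha, card_point_eq_add_sum_quadraticChar hF _ hc, ZMod.card]
    ring
  obtain ⟨htwo, hfour⟩ := two_dvd_and_four_dvd_sum_quadraticChar q hqodd (d : ZMod q)
  rintro m - ⟨j, rfl⟩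
  refine ⟨fun _ => even_iff_two_dvd.mpr ?_, fun hsq => ?_⟩
  · exact dvd_odd_index_of_recursion hu1 hurec (ha' ▸ (dvd_neg.mpr htwo)) j
  · exact dvd_odd_index_of_recursion hu1 hurec (ha' ▸ (dvd_neg.mpr (hfour hsq))) j
end

section
/- Let q be a prime with q ≡ 1 (mod 4) and let d be an integer not divisible by q such that d is not a square modulo q. Set a = q + 1 − #E_d(F_q) and b = q + 1 − #E₁(F_q), where E_d : y² = x³ − dx and E₁ : y² = x³ − x over F_q. Then a and b are even and (a/2)² + (b/2)² = q. -/
open Finset in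
/-- The sum `∑ χ((u - c)(v - c))` over `c` in a finite field of odd characteristic, for the
quadratic character `χ`. -/
lemma sum_quadraticChar_sub_mul_sub {F : Type*} [Field F] [Fintype F] [DecidableEq F]
    (hF : ringChar F ≠ 2) (u v : F) :
    ∑ c, quadraticChar F (u - c) * quadraticChar F (v - c) =
      (if u = v then (Fintype.card F : ℤ) else 0) - 1 := by
  split_ifs with h
  · subst h
    have hshift := (Equiv.subLeft u).sum_comp fun c ↦ quadraticChar F c * quadraticChar F c
    simp only [Equiv.subLeft_apply] at hshift
    rw [hshift, ← add_sum_erase _ _ (mem_univ (0 : F)), sum_congr rfl (g := fun _ ↦ (1 : ℤ))]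
    · simp [card_erase_of_mem, Nat.cast_sub (Fintype.card_pos (α := F))]
    · intro x hx
      rw [← sq, quadraticChar_sq_one (ne_of_mem_erase hx)]
  · have hw : u - v ≠ 0 := sub_ne_zero.mpr h
    have hJ := jacobiSum_nontrivial_inv (quadraticChar_ne_one hF)
    rw [(quadraticChar_isQuadratic F).inv, jacobiSum] at hJ
    have hbij : Function.Bijective fun x : F ↦ u - (u - v) * x :=
      (Equiv.subLeft u).bijective.comp (mulLeft_bijective₀ _ hw)
    rw [← hbij.sum_comp]
    have key (x : F) : quadraticChar F (u - (u - (u - v) * x)) *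
        quadraticChar F (v - (u - (u - v) * x)) =
        quadraticChar F (-1) * (quadraticChar F x * quadraticChar F (1 - x)) := by
      rw [show u - (u - (u - v) * x) = (u - v) * x by ring,
        show v - (u - (u - v) * x) = (-1) * ((u - v) * (1 - x)) by ring]
      simp only [map_mul]
      linear_combination (quadraticChar F (-1) * (quadraticChar F x * quadraticChar F (1 - x))) *
        quadraticChar_sq_one hw
    simp_rw [key, ← mul_sum, hJ]
    linear_combination - quadraticChar_sq_one (F := F) (a := -1) (by simp)

open Finset in
/-- The sum of the quadratic character over the values `x³ - cx`. -/
def cubicCharSum (F : Type*) [Field F] [Fintype F] [DecidableEq F] (c : F) : ℤ :=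
  ∑ x, quadraticChar F (x ^ 3 - c * x)

namespace cubicCharSum

open Finset

variable {F : Type*} [Field F] [Fintype F] [DecidableEq F]

lemma eq_sum_mul (c : F) :
    cubicCharSum F c = ∑ x, quadraticChar F x * quadraticChar F (x ^ 2 - c) := by
  refine sum_congr rfl fun x _ ↦ ?_
  rw [← map_mul]
  ring_nf

lemma zero_right (hF : ringChar F ≠ 2) : cubicCharSum F 0 = 0 := by
  rw [← quadraticChar_sum_zero hF]
  refine sum_congr rfl fun x _ ↦ ?_
  rcases eq_or_ne x 0 with rfl | hx
  · simp
  · rw [zero_mul, sub_zero, pow_succ, map_mul, quadraticChar_sq_one' hx, one_mul]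

lemma sq_mul_sq {t : F} (ht : t ≠ 0) (c : F) :
    cubicCharSum F (t ^ 2 * c) ^ 2 = cubicCharSum F c ^ 2 := by
  have h : cubicCharSum F (t ^ 2 * c) = quadraticChar F t * cubicCharSum F c := by
    rw [cubicCharSum, ← (mulLeft_bijective₀ t ht).sum_comp, cubicCharSum, mul_sum]
    refine sum_congr rfl fun x _ ↦ ?_
    rw [show (t * x) ^ 3 - t ^ 2 * c * (t * x) = t ^ 2 * (t * (x ^ 3 - c * x)) by ring,
      map_mul, map_mul, quadraticChar_sq_one' ht, one_mul]
  rw [h, mul_pow, quadraticChar_sq_one ht, one_mul]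

lemma sq_eq_sq_of_quadraticChar_eq {c e : F} (he : e ≠ 0)
    (h : quadraticChar F c = quadraticChar F e) : cubicCharSum F c ^ 2 = cubicCharSum F e ^ 2 := by
  have hc : c ≠ 0 := by
    rintro rfl
    exact he (quadraticChar_eq_zero_iff.mp (by simpa using h.symm))
  obtain ⟨t, ht⟩ := (quadraticChar_one_iff_isSquare (mul_ne_zero hc he)).mp (by
    rw [map_mul, h, ← sq, quadraticChar_sq_one he])
  have ht0 : t ≠ 0 := by
    rintro rfl
    exact mul_ne_zero hc he (by simpa using ht)
  rw [← sq_mul_sq (div_ne_zero ht0 he) e]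
  congr 2
  field_simp
  linear_combination ht

lemma sum_sq (hF : ringChar F ≠ 2) (hneg : IsSquare (-1 : F)) :
    ∑ c, cubicCharSum F c ^ 2 = 2 * Fintype.card F * (Fintype.card F - 1) := by
  have hχneg : quadraticChar F (-1) = 1 :=
    (quadraticChar_one_iff_isSquare (by simp)).mpr hneg
  have hinner (x : F) : ∑ y, (if x ^ 2 = y ^ 2 then quadraticChar F x * quadraticChar F y else 0) =
      if x = 0 then 0 else 2 := by
    split_ifs with hx
    · simp [hx]
    · rw [← sum_filter]
      have hset : ({y | x ^ 2 = y ^ 2} : Finset F) = {x, -x} := by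
        ext y
        rw [mem_filter_univ, eq_comm, sq_eq_sq_iff_eq_or_eq_neg, mem_insert, mem_singleton]
      have hne : x ≠ -x := fun h ↦ hx ((Ring.eq_self_iff_eq_zero_of_char_ne_two hF).mp h.symm)
      rw [hset, sum_pair hne, neg_eq_neg_one_mul x, map_mul, hχneg]
      linear_combination 2 * quadraticChar_sq_one hx
  calc ∑ c, cubicCharSum F c ^ 2
      = ∑ x, ∑ y, quadraticChar F x * quadraticChar F y *
          ∑ c, quadraticChar F (x ^ 2 - c) * quadraticChar F (y ^ 2 - c) := by
        simp_rw [eq_sum_mul, sq (∑ x, _), sum_mul_sum, mul_sum]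
        rw [sum_comm]
        refine sum_congr rfl fun x _ ↦ ?_
        rw [sum_comm]
        refine sum_congr rfl fun y _ ↦ sum_congr rfl fun c _ ↦ by ring
    _ = Fintype.card F * (∑ x : F, ∑ y : F,
          if x ^ 2 = y ^ 2 then quadraticChar F x * quadraticChar F y else 0) -
          (∑ x, quadraticChar F x) * ∑ y, quadraticChar F y := by
        simp_rw [sum_quadraticChar_sub_mul_sub hF, sum_mul_sum, mul_sum, ← sum_sub_distrib]
        refine sum_congr rfl fun x _ ↦ sum_congr rfl fun y _ ↦ ?_
        split_ifs <;> ring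
    _ = 2 * Fintype.card F * (Fintype.card F - 1) := by
        simp_rw [hinner, quadraticChar_sum_zero hF]
        rw [← add_sum_erase _ _ (mem_univ (0 : F)), sum_congr rfl (g := fun _ ↦ (2 : ℤ))]
        · simp [card_erase_of_mem, Nat.cast_sub (Fintype.card_pos (α := F))]
          ring
        · intro x hx
          rw [if_neg (ne_of_mem_erase hx)]

lemma sq_one_add_sq (hF : ringChar F ≠ 2) (hneg : IsSquare (-1 : F)) {d : F}
    (hd : ¬ IsSquare d) : cubicCharSum F 1 ^ 2 + cubicCharSum F d ^ 2 = 4 * Fintype.card F := by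
  have hd0 : d ≠ 0 := by
    rintro rfl
    exact hd .zero
  have hχd : quadraticChar F d = -1 := quadraticChar_neg_one_iff_not_isSquare.mpr hd
  have hsum : ∑ c, 2 * cubicCharSum F c ^ 2 =
      ∑ c, ((if c = 0 then 0 else cubicCharSum F 1 ^ 2 + cubicCharSum F d ^ 2) +
        quadraticChar F c * (cubicCharSum F 1 ^ 2 - cubicCharSum F d ^ 2)) := by
    refine sum_congr rfl fun c _ ↦ ?_
    rcases eq_or_ne c 0 with rfl | hc
    · simp [zero_right hF]
    rw [if_neg hc]
    rcases quadraticChar_dichotomy hc with h | h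
    · rw [h, sq_eq_sq_of_quadraticChar_eq one_ne_zero (h.trans (map_one _).symm)]
      ring
    · rw [h, sq_eq_sq_of_quadraticChar_eq hd0 (h.trans hχd.symm)]
      ring
  rw [← mul_sum, sum_sq hF hneg, sum_add_distrib, ← sum_mul, quadraticChar_sum_zero hF,
    ← add_sum_erase _ _ (mem_univ (0 : F)), sum_congr rfl
      (g := fun _ ↦ cubicCharSum F 1 ^ 2 + cubicCharSum F d ^ 2)
      fun x hx ↦ if_neg (ne_of_mem_erase hx)] at hsum
  simp only [if_true, sum_const, card_erase_of_mem (mem_univ (0 : F)), card_univ, nsmul_eq_mul,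
    Nat.cast_sub (Fintype.card_pos (α := F)), Nat.cast_one, zero_mul, zero_add, add_zero] at hsum
  have hcard : (Fintype.card F : ℤ) - 1 ≠ 0 := by
    have := Fintype.one_lt_card (α := F)
    lia
  exact mul_left_cancel₀ hcard (by linear_combination -hsum)

/-- The number of points on `y² = x³ - cx` over a finite field of odd characteristic. -/
lemma card_point (hF : ringChar F ≠ 2) {c : F} (hc : c ≠ 0) :
    (Nat.card ({ a₁ := 0, a₂ := 0, a₃ := 0, a₄ := -c, a₆ := 0 } :
      WeierstrassCurve F).toAffine.Point : ℤ) = Fintype.card F + 1 + cubicCharSum F c := by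
  set W : WeierstrassCurve F := { a₁ := 0, a₂ := 0, a₃ := 0, a₄ := -c, a₆ := 0 } with hW
  have h2 : (2 : F) ≠ 0 := Ring.two_ne_zero hF
  have hΔ : W.Δ ≠ 0 := by
    have : W.Δ = 2 ^ 6 * c ^ 3 := by
      simp only [hW, WeierstrassCurve.Δ, WeierstrassCurve.b₂, WeierstrassCurve.b₄,
        WeierstrassCurve.b₆, WeierstrassCurve.b₈]
      ring
    rw [this]
    exact mul_ne_zero (pow_ne_zero _ h2) (pow_ne_zero _ hc)
  have hns (x y : F) : W.toAffine.Nonsingular x y ↔ y ^ 2 = x ^ 3 - c * x := by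
    rw [← W.toAffine.equation_iff_nonsingular_of_Δ_ne_zero hΔ,
      WeierstrassCurve.Affine.equation_iff]
    simp [hW, sub_eq_add_neg]
  let e : {xy : F × F // W.toAffine.Nonsingular xy.1 xy.2} ≃
      Σ x : F, {y : F // y ^ 2 = x ^ 3 - c * x} :=
    (Equiv.subtypeEquivRight fun xy : F × F ↦ hns xy.1 xy.2).trans
      (Equiv.subtypeProdEquivSigmaSubtype fun x y ↦ y ^ 2 = x ^ 3 - c * x)
  rw [Nat.card_congr ((WeierstrassCurve.Affine.nonsingularPointEquiv W.toAffine).trans e.optionCongr),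
    Nat.card_eq_fintype_card, Fintype.card_option, Fintype.card_sigma]
  have hfib (x : F) : (Fintype.card {y : F // y ^ 2 = x ^ 3 - c * x} : ℤ) =
      quadraticChar F (x ^ 3 - c * x) + 1 := by
    rw [← quadraticChar_card_sqrts hF, Set.toFinset_card]
    rfl
  push_cast
  simp_rw [hfib, sum_add_distrib, cubicCharSum]
  simp
  ring

end cubicCharSum

/-- For a prime `q ≡ 1 (mod 4)` and `d` not divisible by `q` and not a square mod `q`, the
traces `a` of `y² = x³ − dx` and `b` of `y² = x³ − x` over `F_q` are even and satisfy
`(a/2)² + (b/2)² = q`. -/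
theorem trace_sum_of_squares (q : ℕ) (hq : q.Prime) (hq1 : q % 4 = 1)
    (d : ℤ) (hqd : ¬ ((q : ℤ) ∣ d)) (hns : ¬ IsSquare (d : ZMod q))
    (a b : ℤ)
    (ha : a = (q : ℤ) + 1 -
      (Nat.card (({ a₁ := 0, a₂ := 0, a₃ := 0, a₄ := -(d : ZMod q), a₆ := 0 } :
        WeierstrassCurve (ZMod q)).toAffine.Point) : ℤ))
    (hb : b = (q : ℤ) + 1 -
      (Nat.card (({ a₁ := 0, a₂ := 0, a₃ := 0, a₄ := -1, a₆ := 0 } :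
        WeierstrassCurve (ZMod q)).toAffine.Point) : ℤ)) :
    Even a ∧ Even b ∧ (a / 2) ^ 2 + (b / 2) ^ 2 = (q : ℤ) := by
  have : Fact q.Prime := ⟨hq⟩
  have hF : ringChar (ZMod q) ≠ 2 := by
    rw [ZMod.ringChar_zmod_n]
    lia
  have hneg : IsSquare (-1 : ZMod q) := ZMod.exists_sq_eq_neg_one_iff.mpr (by lia)
  have hd0 : (d : ZMod q) ≠ 0 := fun h ↦ hqd ((ZMod.intCast_zmod_eq_zero_iff_dvd d q).mp h)
  have key := cubicCharSum.sq_one_add_sq hF hneg hns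
  rw [cubicCharSum.card_point hF hd0, ZMod.card] at ha
  rw [cubicCharSum.card_point hF one_ne_zero, ZMod.card] at hb
  have hab : a ^ 2 + b ^ 2 = 4 * q := by
    rw [ZMod.card] at key
    subst ha hb
    linear_combination key
  have hmod : Even a ∧ Even b := by
    rcases Int.even_or_odd' a with ⟨m, rfl | rfl⟩ <;> rcases Int.even_or_odd' b with ⟨n, rfl | rfl⟩
    · exact ⟨even_two_mul m, even_two_mul n⟩
    all_goals
      ring_nf at hab
      lia
  obtain ⟨⟨m, rfl⟩, ⟨n, rfl⟩⟩ := hmod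
  refine ⟨⟨m, rfl⟩, ⟨n, rfl⟩, ?_⟩
  rw [← two_mul, ← two_mul, Int.mul_ediv_cancel_left m two_ne_zero,
    Int.mul_ediv_cancel_left n two_ne_zero]
  linarith
end

section
/- Let d be an odd squarefree positive integer with m = ω(d) distinct prime factors. For each positive divisor D of d, let a^{(D)} : ℕ → ℤ be a multiplicative function with a^{(D)}(1) = 1 such that: a^{(D)}(p^k) = 0 for every prime p dividing 2d and every k ≥ 1; a^{(D)}(q^{k+1}) = a^{(D)}(q)·a^{(D)}(q^k) − q·a^{(D)}(q^{k−1}) for every prime q not dividing 2d and every k ≥ 1; and a^{(D)}(q) = J(D|q)·a^{(1)}(q) for every prime q not dividing 2d. Then for every positive integer n coprime to 2d, ∑_{D ∣ d} (−1)^{ω(D)} a^{(D)}(n) = a^{(1)}(n) · ∏_{p ∣ d, p prime} (1 − J(p|n)); in particular this sum equals 2^m·a^{(1)}(n) if J(p|n) = −1 for every prime p ∣ d, and equals 0 otherwise. -/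
/-- A sequence satisfying a weight two Hecke recursion at `q`, whose value at `q` is that of a second
such sequence multiplied by a sign `ε`, is at `q ^ k` the second one multiplied by `ε ^ k`. -/
theorem hecke_prime_pow_twist {f g : ℕ → ℤ} {q : ℕ} {ε : ℤ} (hε : ε ^ 2 = 1)
    (hf1 : f 1 = 1) (hg1 : g 1 = 1) (hfg : f q = ε * g q)
    (hf : ∀ k : ℕ, 1 ≤ k → f (q ^ (k + 1)) = f q * f (q ^ k) - (q : ℤ) * f (q ^ (k - 1)))
    (hg : ∀ k : ℕ, 1 ≤ k → g (q ^ (k + 1)) = g q * g (q ^ k) - (q : ℤ) * g (q ^ (k - 1)))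
    (k : ℕ) : f (q ^ k) = ε ^ k * g (q ^ k) := by
  induction k using Nat.twoStepInduction with
  | zero => simp [hf1, hg1]
  | one => simpa using hfg
  | more k ih₀ ih₁ =>
    rw [hf (k + 1) (by omega), hg (k + 1) (by omega), Nat.add_sub_cancel, ih₀, ih₁, hfg]
    linear_combination (q : ℤ) * ε ^ k * g (q ^ k) * hε

/-- A multiplicative function which at each prime power coprime to `N` is the twist by `J(D|·)`
of another one is its twist at every positive integer coprime to `N`. -/
theorem eq_jacobiSym_mul_of_prime_pow {f g : ℕ → ℤ} {N : ℕ} {D : ℤ}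
    (hf1 : f 1 = 1) (hg1 : g 1 = 1)
    (hf : ∀ m n : ℕ, m.Coprime n → f (m * n) = f m * f n)
    (hg : ∀ m n : ℕ, m.Coprime n → g (m * n) = g m * g n)
    (hfg : ∀ q : ℕ, q.Prime → q.Coprime N → ∀ k, f (q ^ k) = jacobiSym D q ^ k * g (q ^ k))
    {n : ℕ} (hn : n ≠ 0) (hnN : n.Coprime N) : f n = jacobiSym D n * g n := by
  induction n using Nat.recOnPosPrimePosCoprime with
  | zero => exact absurd rfl hn
  | one => simp [hf1, hg1]
  | prime_pow q k hq hk =>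
    rw [jacobiSym.pow_right]
    exact hfg q hq ((Nat.coprime_pow_left_iff hk _ _).1 hnN) k
  | coprime m n hm hn' hmn ihm ihn =>
    rw [hf m n hmn, hg m n hmn, jacobiSym.mul_right' D (by omega) (by omega),
      ihm (by omega) hnN.coprime_mul_right, ihn (by omega) hnN.coprime_mul_left]
    ring

/-- The alternating sum of the Jacobi symbols `J(D|n)` over the divisors `D` of a squarefree `d`
factors as a product over the primes dividing `d`. -/
theorem sum_divisors_neg_one_pow_mul_jacobiSym {d : ℕ} (hd : Squarefree d) (n : ℕ) :
    ∑ D ∈ d.divisors, (-1 : ℤ) ^ D.primeFactors.card * jacobiSym (D : ℤ) n =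
      ∏ p ∈ d.primeFactors, (1 - jacobiSym (p : ℤ) n) := by
  let J : ArithmeticFunction ℤ := ⟨fun D => if D = 0 then 0 else jacobiSym (D : ℤ) n, by simp⟩
  have hJ (D : ℕ) (hD : D ≠ 0) : J D = jacobiSym (D : ℤ) n := if_neg hD
  have hJmul : J.IsMultiplicative := by
    rw [ArithmeticFunction.IsMultiplicative.iff_ne_zero]
    refine ⟨by simp [hJ, jacobiSym.one_left], fun {a b} ha hb _ => ?_⟩
    rw [hJ _ (mul_ne_zero ha hb), hJ a ha, hJ b hb, Nat.cast_mul, jacobiSym.mul_left]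
  have h := ArithmeticFunction.IsMultiplicative.prodPrimeFactors_one_sub_of_squarefree J hJmul hd
  rw [Finset.prod_congr rfl fun p hp => by
    rw [← hJ p (Nat.prime_of_mem_primeFactors hp).ne_zero], h]
  refine Finset.sum_congr rfl fun D hD => ?_
  have hDsf := hd.squarefree_of_dvd (Nat.dvd_of_mem_divisors hD)
  rw [hJ D hDsf.ne_zero, Int.cast_id, ArithmeticFunction.moebius_apply_of_squarefree hDsf,
    ← (ArithmeticFunction.cardDistinctFactors_eq_cardFactors_iff_squarefree hDsf.ne_zero).2 hDsf]
  rfl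

/-- Key claim for the congruence number bound: if for each positive divisor `D` of `d` the
multiplicative function `a D` vanishes at prime powers of primes dividing `2d`, satisfies the
Hecke recursion away from `2d`, and twists by `J(D|·)` at primes away from `2d`, then for `n`
coprime to `2d`, `∑_{D ∣ d} (−1)^{ω(D)} a D n = a 1 n · ∏_{p ∣ d} (1 − J(p|n))`; in particular
the sum is `2^{ω(d)}·a 1 n` if `J(p|n) = −1` for all primes `p ∣ d`, and `0` otherwise. -/
theorem sum_twisted_coefficients (d : ℕ) (hd : Odd d) (hsf : Squarefree d) (hdpos : 0 < d)
    (a : ℕ → ℕ → ℤ)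
    (ha1 : ∀ D ∈ d.divisors, a D 1 = 1)
    (hmul : ∀ D ∈ d.divisors, ∀ m n : ℕ, Nat.Coprime m n → a D (m * n) = a D m * a D n)
    (hbad : ∀ D ∈ d.divisors, ∀ p : ℕ, p.Prime → p ∣ 2 * d → ∀ k : ℕ, 1 ≤ k →
      a D (p ^ k) = 0)
    (hrec : ∀ D ∈ d.divisors, ∀ q : ℕ, q.Prime → ¬ (q ∣ 2 * d) → ∀ k : ℕ, 1 ≤ k →
      a D (q ^ (k + 1)) = a D q * a D (q ^ k) - (q : ℤ) * a D (q ^ (k - 1)))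
    (htwist : ∀ D ∈ d.divisors, ∀ q : ℕ, q.Prime → ¬ (q ∣ 2 * d) →
      a D q = jacobiSym (D : ℤ) q * a 1 q) :
    ∀ n : ℕ, 0 < n → n.Coprime (2 * d) →
      ((∑ D ∈ d.divisors, (-1 : ℤ) ^ D.primeFactors.card * a D n) =
        a 1 n * ∏ p ∈ d.primeFactors, (1 - jacobiSym (p : ℤ) n)) ∧
      ((∀ p ∈ d.primeFactors, jacobiSym (p : ℤ) n = -1) →
        (∑ D ∈ d.divisors, (-1 : ℤ) ^ D.primeFactors.card * a D n) =
          2 ^ d.primeFactors.card * a 1 n) ∧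
      ((∃ p ∈ d.primeFactors, jacobiSym (p : ℤ) n ≠ -1) →
        (∑ D ∈ d.divisors, (-1 : ℤ) ^ D.primeFactors.card * a D n) = 0) := by
  intro n hn hnc
  have h1 : 1 ∈ d.divisors := Nat.one_mem_divisors.2 hsf.ne_zero
  have htw : ∀ D ∈ d.divisors, a D n = jacobiSym (D : ℤ) n * a 1 n := by
    intro D hD
    refine eq_jacobiSym_mul_of_prime_pow (ha1 D hD) (ha1 1 h1) (hmul D hD) (hmul 1 h1)
      (fun q hq hqc => ?_) hn.ne' hnc
    have hqd : ¬ q ∣ 2 * d := (Nat.Prime.coprime_iff_not_dvd hq).1 hqc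
    have hDq : Int.gcd (D : ℤ) q = 1 := by
      rw [Int.gcd_natCast_natCast]
      exact (hqc.coprime_dvd_right ((Nat.dvd_of_mem_divisors hD).mul_left 2)).symm
    exact hecke_prime_pow_twist (jacobiSym.sq_one hDq) (ha1 D hD) (ha1 1 h1)
      (htwist D hD q hq hqd) (hrec D hD q hq hqd) (hrec 1 h1 q hq hqd)
  have hsum : (∑ D ∈ d.divisors, (-1 : ℤ) ^ D.primeFactors.card * a D n) =
      a 1 n * ∏ p ∈ d.primeFactors, (1 - jacobiSym (p : ℤ) n) := by
    rw [← sum_divisors_neg_one_pow_mul_jacobiSym hsf, Finset.mul_sum]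
    refine Finset.sum_congr rfl fun D hD => ?_
    rw [htw D hD]
    ring
  refine ⟨hsum, fun h => ?_, fun ⟨p, hp, hne⟩ => ?_⟩
  · rw [hsum, Finset.prod_congr rfl fun p hp => by rw [h p hp], Finset.prod_const, mul_comm]
    norm_num
  · have hpn : Int.gcd (p : ℤ) n = 1 := by
      rw [Int.gcd_natCast_natCast]
      exact (hnc.coprime_dvd_right ((Nat.dvd_of_mem_primeFactors hp).mul_left 2)).symm
    have hp1 : jacobiSym (p : ℤ) n = 1 := (jacobiSym.eq_one_or_neg_one hpn).resolve_right hne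
    rw [hsum, Finset.prod_eq_zero hp (by rw [hp1, sub_self]), mul_zero]
end
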